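/- arXiv:1003.4605 — 3 statements merged into one kernel-verified Lean document; each statement's English description precedes it below -/
import Mathlib

section
/- Let N ≥ 2 be an integer and suppose the element (x − α)(β − x) of ℝ[C] can be written as a sum of squares g₁² + ⋯ + g_r² with δ(g_j) ≤ N for all j. Then every nonzero psd f ∈ ℝ[C] satisfies θ(f) ≤ N − 1 + ⌈δ(f)/2⌉. -/
open Polynomial

noncomputable section

/-- The defining polynomial `y² + q(x)` of the curve, as a polynomial in `y`
over `ℝ[x]`. -/
def curvePoly (q : Polynomial ℝ) : Polynomial (Polynomial ℝ) :=
  X ^ 2 + C q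

lemma curvePoly_monic (q : Polynomial ℝ) : (curvePoly q).Monic :=
  Polynomial.monic_X_pow_add_C q (by norm_num)

/-- The coordinate ring `ℝ[C] = ℝ[x,y]/(y² + q(x))`. -/
abbrev CurveRing (q : Polynomial ℝ) : Type := AdjoinRoot (curvePoly q)

/-- The unique representative `a(x) + b(x)·y` (of `y`-degree `< 2`) of an element. -/
def curveRep (q : Polynomial ℝ) (f : CurveRing q) : Polynomial (Polynomial ℝ) :=
  AdjoinRoot.modByMonicHom (curvePoly_monic q) f

/-- The polynomial `a(x)` with `f = a(x) + b(x)·y`. -/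
def repA (q : Polynomial ℝ) (f : CurveRing q) : Polynomial ℝ := (curveRep q f).coeff 0

/-- The polynomial `b(x)` with `f = a(x) + b(x)·y`. -/
def repB (q : Polynomial ℝ) (f : CurveRing q) : Polynomial ℝ := (curveRep q f).coeff 1

/-- `δ(f) = max (deg a, 2 + deg b)` for `f = a(x) + b(x)·y ≠ 0`. -/
def curveDelta (q : Polynomial ℝ) (f : CurveRing q) : ℕ :=
  if repB q f = 0 then (repA q f).natDegree
  else max (repA q f).natDegree (2 + (repB q f).natDegree)

/-- `f ∈ ℝ[C]` is psd: nonnegative at all real points of the curve. -/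
def IsPsd (q : Polynomial ℝ) (f : CurveRing q) : Prop :=
  ∀ u v : ℝ, v ^ 2 + q.eval u = 0 → 0 ≤ (repA q f).eval u + (repB q f).eval u * v

/-- `f` is a sum of squares of elements of `δ`-degree at most `d`. -/
def IsSosLe (q : Polynomial ℝ) (f : CurveRing q) (d : ℕ) : Prop :=
  ∃ (r : ℕ) (g : Fin r → CurveRing q), f = ∑ i, g i ^ 2 ∧ ∀ i, curveDelta q (g i) ≤ d

/-- `θ(f)`: the least `d` such that `f` is a sum of squares of elements of
`δ`-degree `≤ d`, and `∞` if `f` is not a sum of squares. -/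
def curveTheta (q : Polynomial ℝ) (f : CurveRing q) : ℕ∞ :=
  sInf {d : ℕ∞ | ∃ n : ℕ, d = (n : ℕ∞) ∧ IsSosLe q f n}

/-- All zeros of `f` on `C(ℂ)` are real. -/
def AllZerosReal (q : Polynomial ℝ) (f : CurveRing q) : Prop :=
  ∀ u v : ℂ, v ^ 2 + (q.map (algebraMap ℝ ℂ)).eval u = 0 →
    ((repA q f).map (algebraMap ℝ ℂ)).eval u +
      ((repB q f).map (algebraMap ℝ ℂ)).eval u * v = 0 →
    u.im = 0 ∧ v.im = 0

/-- The element `a(x) + b(x)·y` of the coordinate ring. -/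
def curveElem (q a b : ℝ[X]) : CurveRing q :=
  AdjoinRoot.mk (curvePoly q) (C a + C b * X)

lemma curveRep_curveElem (q a b : ℝ[X]) : curveRep q (curveElem q a b) = C a + C b * X := by
  unfold curveRep curveElem
  rw [AdjoinRoot.modByMonicHom_mk, modByMonic_eq_self_iff (curvePoly_monic q)]
  have h2 : (curvePoly q).degree = 2 := degree_X_pow_add_C (by norm_num) q
  rw [h2, add_comm]
  exact lt_of_le_of_lt degree_linear_le (by norm_num)

@[simp] lemma repA_curveElem (q a b : ℝ[X]) : repA q (curveElem q a b) = a := by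
  simp [repA, curveRep_curveElem]

@[simp] lemma repB_curveElem (q a b : ℝ[X]) : repB q (curveElem q a b) = b := by
  simp [repB, curveRep_curveElem]

lemma curveElem_rep (q : ℝ[X]) (f : CurveRing q) : curveElem q (repA q f) (repB q f) = f := by
  have hlt : (curveRep q f).degree < 2 := by
    obtain ⟨p, rfl⟩ := AdjoinRoot.mk_surjective f
    have h2 : (curvePoly q).degree = 2 := degree_X_pow_add_C (by norm_num) q
    unfold curveRep
    rw [AdjoinRoot.modByMonicHom_mk, ← h2]
    exact degree_modByMonic_lt _ (curvePoly_monic q)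
  have hle : (curveRep q f).degree ≤ 1 := Order.le_of_lt_succ hlt
  have h := eq_X_add_C_of_degree_le_one hle
  have hinv := AdjoinRoot.mk_leftInverse (curvePoly_monic q) f
  unfold curveElem repA repB
  rw [add_comm, ← h]
  exact hinv

lemma curveRing_ext {q : ℝ[X]} {f g : CurveRing q} (hA : repA q f = repA q g)
    (hB : repB q f = repB q g) : f = g := by
  rw [← curveElem_rep q f, ← curveElem_rep q g, hA, hB]

lemma curveElem_mul (q a b c d : ℝ[X]) :
    curveElem q a b * curveElem q c d = curveElem q (a * c - q * (b * d)) (a * d + b * c) := by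
  unfold curveElem
  rw [← map_mul, AdjoinRoot.mk_eq_mk]
  refine ⟨C (b * d), ?_⟩
  simp only [curvePoly, map_sub, map_add, map_mul]
  ring

lemma of_eq_curveElem (q p : ℝ[X]) : AdjoinRoot.of (curvePoly q) p = curveElem q p 0 := by
  simp [curveElem, AdjoinRoot.mk_C]

section rep
variable (q : ℝ[X]) (f g : CurveRing q)

@[simp] lemma repA_add : repA q (f + g) = repA q f + repA q g := by simp [repA, curveRep]
@[simp] lemma repB_add : repB q (f + g) = repB q f + repB q g := by simp [repB, curveRep]
@[simp] lemma repA_sub : repA q (f - g) = repA q f - repA q g := by simp [repA, curveRep]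
@[simp] lemma repB_sub : repB q (f - g) = repB q f - repB q g := by simp [repB, curveRep]
@[simp] lemma repA_zero : repA q 0 = 0 := by simp [repA, curveRep]
@[simp] lemma repB_zero : repB q 0 = 0 := by simp [repB, curveRep]

@[simp] lemma repA_mul : repA q (f * g) = repA q f * repA q g - q * (repB q f * repB q g) := by
  conv_lhs => rw [← curveElem_rep q f, ← curveElem_rep q g, curveElem_mul, repA_curveElem]

@[simp] lemma repB_mul : repB q (f * g) = repA q f * repB q g + repB q f * repA q g := by
  conv_lhs => rw [← curveElem_rep q f, ← curveElem_rep q g, curveElem_mul, repB_curveElem]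

@[simp] lemma repA_of (p : ℝ[X]) : repA q (AdjoinRoot.of (curvePoly q) p) = p := by
  rw [of_eq_curveElem, repA_curveElem]
@[simp] lemma repB_of (p : ℝ[X]) : repB q (AdjoinRoot.of (curvePoly q) p) = 0 := by
  rw [of_eq_curveElem, repB_curveElem]

lemma smul_eq_of_mul (c : ℝ) : c • f = AdjoinRoot.of (curvePoly q) (C c) * f := by
  rw [Algebra.smul_def]; rfl

@[simp] lemma repA_smul (c : ℝ) : repA q (c • f) = C c * repA q f := by
  simp [smul_eq_of_mul]
@[simp] lemma repB_smul (c : ℝ) : repB q (c • f) = C c * repB q f := by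
  simp [smul_eq_of_mul]

/-- The norm `a² + q b²` of `f = a + b y` down to `ℝ[x]`. -/
def curveNorm : ℝ[X] := repA q f ^ 2 + q * repB q f ^ 2

lemma curveNorm_mul : curveNorm q (f * g) = curveNorm q f * curveNorm q g := by
  simp only [curveNorm, repA_mul, repB_mul]; ring

@[simp] lemma curveNorm_of (p : ℝ[X]) :
    curveNorm q (AdjoinRoot.of (curvePoly q) p) = p ^ 2 := by simp [curveNorm]

/-- The value of `f` at the point `(u, v)`. -/
def curveEval (u v : ℝ) : ℝ := (repA q f).eval u + (repB q f).eval u * v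

lemma curveEval_add (u v : ℝ) :
    curveEval q (f + g) u v = curveEval q f u v + curveEval q g u v := by
  simp [curveEval]; ring

lemma curveEval_sub (u v : ℝ) :
    curveEval q (f - g) u v = curveEval q f u v - curveEval q g u v := by
  simp [curveEval]; ring

lemma curveEval_smul (c : ℝ) (u v : ℝ) : curveEval q (c • f) u v = c * curveEval q f u v := by
  simp [curveEval]; ring

lemma curveEval_of (p : ℝ[X]) (u v : ℝ) :
    curveEval q (AdjoinRoot.of (curvePoly q) p) u v = p.eval u := by
  simp [curveEval]

variable {q} in
lemma curveEval_mul {u v : ℝ} (h : v ^ 2 + q.eval u = 0) :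
    curveEval q (f * g) u v = curveEval q f u v * curveEval q g u v := by
  have h' : q.eval u = - v ^ 2 := by linarith
  simp [curveEval, h']; ring

variable {q} in
lemma curveEval_norm {u v : ℝ} (h : v ^ 2 + q.eval u = 0) :
    (curveNorm q f).eval u = curveEval q f u v * curveEval q f u (-v) := by
  have h' : q.eval u = - v ^ 2 := by linarith
  simp [curveEval, curveNorm, h']; ring

end rep

lemma natDegree_sq_add_mul_sq {q : ℝ[X]} (hq : q.Monic) (hdeg : q.natDegree = 4) (a b : ℝ[X]) :
    (a ^ 2 + q * b ^ 2).natDegree =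
      2 * (if b = 0 then a.natDegree else max a.natDegree (2 + b.natDegree)) := by
  split_ifs with hb
  · simp [hb]
  have hb2 : (q * b ^ 2).natDegree = 4 + 2 * b.natDegree := by
    rw [natDegree_mul hq.ne_zero (pow_ne_zero 2 hb), natDegree_pow, hdeg]
  have ha2 : (a ^ 2).natDegree = 2 * a.natDegree := natDegree_pow a 2
  rcases lt_trichotomy (a ^ 2).natDegree (q * b ^ 2).natDegree with h | h | h
  · rw [natDegree_add_eq_right_of_natDegree_lt h, hb2, max_eq_right (by omega)]; ring
  · have hlead : (a ^ 2).leadingCoeff + (q * b ^ 2).leadingCoeff ≠ 0 := by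
      rw [leadingCoeff_pow, leadingCoeff_mul, leadingCoeff_pow, hq.leadingCoeff]
      have : b.leadingCoeff ≠ 0 := leadingCoeff_ne_zero.mpr hb
      positivity
    have hle : (a ^ 2 + q * b ^ 2).natDegree ≤ (a ^ 2).natDegree :=
      natDegree_add_le_of_degree_le le_rfl h.symm.le
    have hge : (a ^ 2).natDegree ≤ (a ^ 2 + q * b ^ 2).natDegree := by
      apply le_natDegree_of_ne_zero
      rw [coeff_add]
      conv_lhs => enter [2]; rw [h]
      exact hlead
    rw [max_eq_left (by omega)]; omega
  · rw [natDegree_add_eq_left_of_natDegree_lt h, ha2, max_eq_left (by omega)]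

section degree
variable {q : ℝ[X]} (hq : q.Monic) (hdeg : q.natDegree = 4)
include hq hdeg

lemma natDegree_curveNorm (f : CurveRing q) :
    (curveNorm q f).natDegree = 2 * curveDelta q f :=
  natDegree_sq_add_mul_sq hq hdeg _ _

lemma curveNorm_ne_zero {f : CurveRing q} (hf : f ≠ 0) : curveNorm q f ≠ 0 := by
  intro h
  have hb : repB q f = 0 := by
    by_contra hb
    have h1 := natDegree_sq_add_mul_sq hq hdeg (repA q f) (repB q f)
    rw [← curveNorm, h, if_neg hb, natDegree_zero] at h1
    have := le_max_right (repA q f).natDegree (2 + (repB q f).natDegree)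
    omega
  have ha : repA q f = 0 := by simpa [curveNorm, hb] using h
  exact hf (curveRing_ext (by simp [ha]) (by simp [hb]))

lemma curveRing_mul_ne_zero {f g : CurveRing q} (hf : f ≠ 0) (hg : g ≠ 0) : f * g ≠ 0 := by
  intro h
  have := mul_ne_zero (curveNorm_ne_zero hq hdeg hf) (curveNorm_ne_zero hq hdeg hg)
  rw [← curveNorm_mul, h] at this
  simp [curveNorm] at this

lemma curveRing_mul_left_cancel {f g h : CurveRing q} (hf : f ≠ 0) (e : f * g = f * h) :
    g = h := by
  by_contra hgh
  exact curveRing_mul_ne_zero hq hdeg hf (sub_ne_zero.mpr hgh) (by rw [mul_sub, e, sub_self])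

lemma curveDelta_mul {f g : CurveRing q} (hf : f ≠ 0) (hg : g ≠ 0) :
    curveDelta q (f * g) = curveDelta q f + curveDelta q g := by
  have h := natDegree_curveNorm hq hdeg (f * g)
  rw [curveNorm_mul, natDegree_mul (curveNorm_ne_zero hq hdeg hf) (curveNorm_ne_zero hq hdeg hg),
    natDegree_curveNorm hq hdeg, natDegree_curveNorm hq hdeg] at h
  omega

end degree

lemma of_ne_zero (q : ℝ[X]) {p : ℝ[X]} (hp : p ≠ 0) : AdjoinRoot.of (curvePoly q) p ≠ 0 := by
  intro h
  apply hp
  rw [← repA_of q p, h, repA_zero]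

lemma curveDelta_of (q p : ℝ[X]) :
    curveDelta q (AdjoinRoot.of (curvePoly q) p) = p.natDegree := by
  simp [curveDelta]

lemma of_dvd_iff (q p : ℝ[X]) (f : CurveRing q) :
    AdjoinRoot.of (curvePoly q) p ∣ f ↔ p ∣ repA q f ∧ p ∣ repB q f := by
  constructor
  · rintro ⟨g, rfl⟩
    simp
  · rintro ⟨⟨a, ha⟩, b, hb⟩
    exact ⟨curveElem q a b, curveRing_ext (by simp [ha]) (by simp [hb])⟩

section sos
variable {q : ℝ[X]} {f g : CurveRing q} {d : ℕ}

lemma IsSosLe.add (hf : IsSosLe q f d) (hg : IsSosLe q g d) : IsSosLe q (f + g) d := by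
  obtain ⟨r, a, rfl, ha⟩ := hf
  obtain ⟨s, b, rfl, hb⟩ := hg
  refine ⟨r + s, Fin.append a b, ?_, ?_⟩
  · simp [Fin.sum_univ_add]
  · intro i
    refine Fin.addCases (fun j => ?_) (fun j => ?_) i
    · simpa using ha j
    · simpa using hb j

lemma isSosLe_zero : IsSosLe q 0 d := ⟨0, Fin.elim0, by simp, fun i => i.elim0⟩

lemma curveDelta_smul_le (c : ℝ) (f : CurveRing q) : curveDelta q (c • f) ≤ curveDelta q f := by
  by_cases hc : c = 0
  · simp [hc, curveDelta]
  · have hB : C c * repB q f = 0 ↔ repB q f = 0 := by simp [hc]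
    simp only [curveDelta, repA_smul, repB_smul, hB, natDegree_C_mul hc]
    exact le_rfl

lemma IsSosLe.smul {c : ℝ} (hc : 0 ≤ c) (hf : IsSosLe q f d) : IsSosLe q (c • f) d := by
  obtain ⟨r, a, rfl, ha⟩ := hf
  refine ⟨r, fun i => √c • a i, ?_, fun i => (curveDelta_smul_le _ _).trans (ha i)⟩
  simp_rw [_root_.smul_pow, Real.sq_sqrt hc, Finset.smul_sum]

end sos

/-- The elements of `δ`-degree at most `k`. -/
def deltaLE (q : ℝ[X]) (k : ℕ) : Submodule ℝ (CurveRing q) where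
  carrier := {f | repA q f ∈ degreeLT ℝ (k + 1) ∧ repB q f ∈ degreeLT ℝ (k - 1)}
  add_mem' hf hg := by
    simp only [Set.mem_ofPred_eq, repA_add, repB_add] at *
    exact ⟨add_mem hf.1 hg.1, add_mem hf.2 hg.2⟩
  zero_mem' := by simp
  smul_mem' c f hf := by
    simp only [Set.mem_ofPred_eq, repA_smul, repB_smul, ← smul_eq_C_mul] at *
    exact ⟨Submodule.smul_mem _ c hf.1, Submodule.smul_mem _ c hf.2⟩

lemma mem_deltaLE {q : ℝ[X]} {k : ℕ} {f : CurveRing q} :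
    f ∈ deltaLE q k ↔ curveDelta q f ≤ k := by
  change repA q f ∈ degreeLT ℝ (k + 1) ∧ repB q f ∈ degreeLT ℝ (k - 1) ↔ _
  have hA : repA q f ∈ degreeLT ℝ (k + 1) ↔ (repA q f).natDegree ≤ k := by
    rw [mem_degreeLT, natDegree_le_iff_degree_le]
    exact Order.lt_succ_iff (b := ((k : ℕ) : WithBot ℕ))
  rw [hA, mem_degreeLT, curveDelta]
  split_ifs with hb
  · simp [hb]
  · rw [degree_eq_natDegree hb, max_le_iff, Nat.cast_lt]
    exact and_congr_right fun _ => by omega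

/-- `(a, b) ↦ a + b y` on the polynomials of bounded degree. -/
def curveElemLin (q : ℝ[X]) : ℝ[X] × ℝ[X] →ₗ[ℝ] CurveRing q where
  toFun p := curveElem q p.1 p.2
  map_add' p r := curveRing_ext (by simp) (by simp)
  map_smul' c p := curveRing_ext (by simp [smul_eq_C_mul]) (by simp [smul_eq_C_mul])

instance (q : ℝ[X]) (k : ℕ) : FiniteDimensional ℝ (deltaLE q k) := by
  have hle : deltaLE q k ≤
      ((degreeLT ℝ (k + 1)).prod (degreeLT ℝ (k - 1))).map (curveElemLin q) := by
    intro f hf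
    exact ⟨(repA q f, repB q f), hf, curveElem_rep q f⟩
  have h1 : (degreeLT ℝ (k + 1)).FG := Module.Finite.iff_fg.mp
    (LinearEquiv.finiteDimensional (degreeLTEquiv ℝ (k + 1)).symm)
  have h2 : (degreeLT ℝ (k - 1)).FG := Module.Finite.iff_fg.mp
    (LinearEquiv.finiteDimensional (degreeLTEquiv ℝ (k - 1)).symm)
  have : FiniteDimensional ℝ
      (((degreeLT ℝ (k + 1)).prod (degreeLT ℝ (k - 1))).map (curveElemLin q)) :=
    Module.Finite.iff_fg.mpr ((h1.prod h2).map _)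
  exact Submodule.finiteDimensional_of_le hle

lemma eval_nonneg_of_eval_ne_zero {A P : ℝ[X]} (hP : P ≠ 0) {U : Set ℝ} (hU : IsOpen U)
    (h : ∀ x ∈ U, P.eval x ≠ 0 → 0 ≤ A.eval x) : ∀ x ∈ U, 0 ≤ A.eval x := by
  intro x hx
  have hd : Dense {x : ℝ | P.eval x ≠ 0} := by
    have hfin : {x : ℝ | P.eval x = 0}.Finite :=
      (P.roots.toFinset.finite_toSet).subset fun x hx => by simpa [hP] using hx
    have := hfin.countable.dense_compl ℝ
    exact this
  have hcl := hd.open_subset_closure_inter hU hx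
  have hc : IsClosed {x : ℝ | 0 ≤ A.eval x} := isClosed_le continuous_const A.continuous
  exact closure_minimal (fun y hy => h y hy.1 hy.2) hc hcl

lemma sq_dvd_of_nonneg {A : ℝ[X]} {u : ℝ} (h0 : A.eval u = 0) {U : Set ℝ} (hU : IsOpen U)
    (hu : u ∈ U) (h : ∀ x ∈ U, 0 ≤ A.eval x) : (X - C u) ^ 2 ∣ A := by
  obtain ⟨B, rfl⟩ := dvd_iff_isRoot.mpr h0
  have hmin : IsLocalMin (fun x => ((X - C u) * B).eval x) u := by
    filter_upwards [hU.mem_nhds hu] with x hx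
    rw [h0]; exact h x hx
  have hB : B.eval u = 0 := by
    have := hmin.hasDerivAt_eq_zero (((X - C u) * B).hasDerivAt u)
    simpa using this
  rw [pow_two]
  exact mul_dvd_mul_left _ (dvd_iff_isRoot.mpr hB)

lemma exists_root_ge {p : ℝ[X]} (hp : 0 < p.leadingCoeff) (hd : 0 < p.natDegree) {x : ℝ}
    (hx : p.eval x ≤ 0) : ∃ y, x ≤ y ∧ p.eval y = 0 := by
  have ht := p.tendsto_atTop_of_leadingCoeff_nonneg (natDegree_pos_iff_degree_pos.mp hd) hp.le
  obtain ⟨z, hz0, hzx⟩ :=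
    ((ht.eventually (Filter.eventually_ge_atTop 0)).and (Filter.eventually_ge_atTop x)).exists
  obtain ⟨y, hy, hy0⟩ := intermediate_value_Icc hzx p.continuous.continuousOn ⟨hx, hz0⟩
  exact ⟨y, hy.1, hy0⟩

lemma exists_root_le {p : ℝ[X]} (hp : p.Monic) (hd : 0 < p.natDegree) (heven : Even p.natDegree)
    {x : ℝ} (hx : p.eval x ≤ 0) : ∃ y, y ≤ x ∧ p.eval y = 0 := by
  have hnd : (p.comp (-X)).natDegree = p.natDegree := by simp [natDegree_comp]
  have hlc : (p.comp (-X)).leadingCoeff = 1 := by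
    rw [leadingCoeff_comp (by simp)]
    simp [hp.leadingCoeff, heven.neg_one_pow]
  obtain ⟨y, hy, hy0⟩ := exists_root_ge (p := p.comp (-X)) (by rw [hlc]; exact one_pos)
    (by omega) (x := -x) (by simpa using hx)
  exact ⟨-y, by linarith, by simpa using hy0⟩

section curve
variable {q : ℝ[X]} (hq : q.Monic) (hdeg : q.natDegree = 4)
include hq hdeg

lemma mem_Icc_of_eval_nonpos {α β : ℝ} (hαβ : ∀ x : ℝ, q.eval x = 0 → α ≤ x ∧ x ≤ β) {x : ℝ}
    (hx : q.eval x ≤ 0) : x ∈ Set.Icc α β := by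
  obtain ⟨y, hy, hy0⟩ := exists_root_ge (by rw [hq.leadingCoeff]; exact one_pos) (by omega) hx
  obtain ⟨z, hz, hz0⟩ := exists_root_le hq (by omega) (by rw [hdeg]; decide) hx
  exact ⟨(hαβ z hz0).1.trans hz, hy.trans (hαβ y hy0).2⟩

lemma isCompact_nonpos : IsCompact {u : ℝ | q.eval u ≤ 0} := by
  have hcl : IsClosed {u : ℝ | q.eval u ≤ 0} := isClosed_le q.continuous continuous_const
  have hbdd : BddAbove {u : ℝ | q.eval u = 0} ∧ BddBelow {u : ℝ | q.eval u = 0} := by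
    have hfin : {x : ℝ | q.eval x = 0}.Finite :=
      (q.roots.toFinset.finite_toSet).subset fun x hx => by simpa [hq.ne_zero] using hx
    exact ⟨hfin.bddAbove, hfin.bddBelow⟩
  obtain ⟨⟨β, hβ⟩, α, hα⟩ := hbdd
  exact (isCompact_Icc (a := α) (b := β)).of_isClosed_subset hcl fun x hx =>
    mem_Icc_of_eval_nonpos hq hdeg (fun y hy => ⟨hα hy, hβ hy⟩) hx

lemma isCompact_curve : IsCompact {p : ℝ × ℝ | p.2 ^ 2 + q.eval p.1 = 0} := by
  have hK := isCompact_nonpos hq hdeg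
  have hcl : IsClosed {p : ℝ × ℝ | p.2 ^ 2 + q.eval p.1 = 0} :=
    isClosed_eq (by have := q.continuous; fun_prop) continuous_const
  obtain ⟨M, hM⟩ := hK.bddBelow_image (f := fun x => q.eval x) q.continuous.continuousOn
  refine (hK.prod (isCompact_Icc (a := -(1 + |M|)) (b := 1 + |M|))).of_isClosed_subset hcl ?_
  rintro ⟨u, v⟩ huv
  have huv' : v ^ 2 + q.eval u = 0 := huv
  have hle : q.eval u ≤ 0 := by nlinarith [sq_nonneg v]
  have hMu : M ≤ q.eval u := hM ⟨u, hle, rfl⟩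
  refine ⟨hle, abs_le.mp ?_⟩
  have h2 : |v| ^ 2 ≤ (1 + |M|) ^ 2 := by
    rw [sq_abs]; nlinarith [abs_nonneg M, neg_abs_le M]
  exact (abs_le_of_sq_le_sq' h2 (by positivity)).2

lemma exists_bound (h : CurveRing q) :
    ∃ K : ℝ, ∀ u v : ℝ, v ^ 2 + q.eval u = 0 → |curveEval q h u v| ≤ K := by
  obtain ⟨K, hK⟩ := (isCompact_curve hq hdeg).exists_bound_of_continuousOn
    (f := fun p : ℝ × ℝ => curveEval q h p.1 p.2) (by
      have h1 := (repA q h).continuous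
      have h2 := (repB q h).continuous
      unfold curveEval
      fun_prop)
  exact ⟨K, fun u v huv => hK (u, v) huv⟩

lemma exists_lower_bound {p : ℝ[X]} (hp : ∀ u : ℝ, q.eval u ≤ 0 → p.eval u ≠ 0) :
    ∃ ε > 0, ∀ u : ℝ, q.eval u ≤ 0 → ε ≤ |p.eval u| := by
  rcases Set.eq_empty_or_nonempty {u : ℝ | q.eval u ≤ 0} with he | hne
  · exact ⟨1, one_pos, fun u hu => absurd (show u ∈ {u : ℝ | q.eval u ≤ 0} from hu) (by simp [he])⟩
  · obtain ⟨u, hu, hmin⟩ := (isCompact_nonpos hq hdeg).exists_isMinOn hne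
      (f := fun u => |p.eval u|) (by have := p.continuous; fun_prop)
    exact ⟨|p.eval u|, abs_pos.mpr (hp u hu), fun w hw => hmin hw⟩

end curve

lemma exists_pos_point {q : ℝ[X]} (hq : q.Monic) (hdeg : q.natDegree = 4)
    (hindef : ∃ x : ℝ, q.eval x < 0) {f : CurveRing q} (hf : f ≠ 0) (hpsd : IsPsd q f) :
    ∃ u v : ℝ, v ^ 2 + q.eval u = 0 ∧ 0 < curveEval q f u v := by
  by_contra! hcon
  have hn := curveNorm_ne_zero hq hdeg hf
  have hU : IsOpen {x : ℝ | q.eval x < 0} := isOpen_lt q.continuous continuous_const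
  obtain ⟨x, hx⟩ := hindef
  have := eval_nonneg_of_eval_ne_zero (A := -1) hn hU (fun u hu hne => by
    exfalso
    have huv : (√(-q.eval u)) ^ 2 + q.eval u = 0 := by
      rw [Real.sq_sqrt (by have : q.eval u < 0 := hu; linarith)]; ring
    have h0 : curveEval q f u (√(-q.eval u)) = 0 := le_antisymm (hcon _ _ huv) (hpsd _ _ huv)
    exact hne (by rw [curveEval_norm f huv, h0, zero_mul])) x hx
  norm_num at this

/-- The elements of `δ`-degree at most `k` bounded in absolute value by a multiple of `f` on the
real points of the curve. -/
def dominatedBy (q : ℝ[X]) (k : ℕ) (f : CurveRing q) : Submodule ℝ (CurveRing q) where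
  carrier := {g | g ∈ deltaLE q k ∧ ∃ c : ℝ, ∀ u v : ℝ, v ^ 2 + q.eval u = 0 →
    |curveEval q g u v| ≤ c * curveEval q f u v}
  add_mem' := by
    rintro g h ⟨hg, c, hc⟩ ⟨hh, d, hd⟩
    refine ⟨add_mem hg hh, c + d, fun u v huv => ?_⟩
    rw [curveEval_add, add_mul]
    exact (abs_add_le _ _).trans (add_le_add (hc u v huv) (hd u v huv))
  zero_mem' := ⟨zero_mem _, 0, fun u v _ => by simp [curveEval]⟩
  smul_mem' := by
    rintro a g ⟨hg, c, hc⟩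
    refine ⟨Submodule.smul_mem _ a hg, |a| * c, fun u v huv => ?_⟩
    rw [curveEval_smul, abs_mul, mul_assoc]
    exact mul_le_mul_of_nonneg_left (hc u v huv) (abs_nonneg a)

section dominated
variable {q : ℝ[X]} {k : ℕ}

lemma dominatedBy_le_deltaLE (f : CurveRing q) : dominatedBy q k f ≤ deltaLE q k :=
  fun _ hg => hg.1

instance (f : CurveRing q) : FiniteDimensional ℝ (dominatedBy q k f) :=
  Submodule.finiteDimensional_of_le (dominatedBy_le_deltaLE f)

lemma self_mem_dominatedBy {f : CurveRing q} (hk : f ∈ deltaLE q k) (hf : IsPsd q f) :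
    f ∈ dominatedBy q k f :=
  ⟨hk, 1, fun u v huv => by rw [one_mul, abs_of_nonneg]; exact hf u v huv⟩

lemma dominatedBy_mono {f g : CurveRing q} (hg : IsPsd q g) (h : g ∈ dominatedBy q k f) :
    dominatedBy q k g ≤ dominatedBy q k f := by
  rintro e ⟨he, c, hc⟩
  obtain ⟨_, d, hd⟩ := h
  refine ⟨he, |c| * d, fun u v huv => (hc u v huv).trans ?_⟩
  rw [mul_assoc]
  have h0 : 0 ≤ curveEval q g u v := hg u v huv
  exact mul_le_mul (le_abs_self c) ((le_abs_self _).trans (hd u v huv)) h0 (abs_nonneg c)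

lemma exists_maximal_sub (hq : q.Monic) (hdeg : q.natDegree = 4)
    (hindef : ∃ x : ℝ, q.eval x < 0) {f g : CurveRing q} (hf : f ≠ 0) (hfpsd : IsPsd q f)
    (hg : IsPsd q g) :
    ∃ t : ℝ, 0 ≤ t ∧ IsPsd q (g - t • f) ∧ f ∉ dominatedBy q k (g - t • f) := by
  obtain ⟨u₀, v₀, h₀, hpos⟩ := exists_pos_point hq hdeg hindef hf hfpsd
  set S : Set ℝ := {t | IsPsd q (g - t • f)} with hS
  have hSmem : ∀ t, t ∈ S ↔ ∀ u v : ℝ, v ^ 2 + q.eval u = 0 →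
      t * curveEval q f u v ≤ curveEval q g u v := by
    intro t
    refine forall_congr' fun u => forall_congr' fun v => forall_congr' fun _ => ?_
    change 0 ≤ curveEval q (g - t • f) u v ↔ _
    rw [curveEval_sub, curveEval_smul, sub_nonneg]
  have hclosed : IsClosed S := by
    have : S = ⋂ (u : ℝ) (v : ℝ) (_ : v ^ 2 + q.eval u = 0),
        {t : ℝ | t * curveEval q f u v ≤ curveEval q g u v} := by
      ext t; rw [hSmem]; simp
    rw [this]
    exact isClosed_iInter fun u => isClosed_iInter fun v => isClosed_iInter fun _ =>
      isClosed_le (by fun_prop) continuous_const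
  have h0 : (0 : ℝ) ∈ S := by
    rw [hSmem]; intro u v huv; rw [zero_mul]; exact hg u v huv
  have hbdd : BddAbove S := by
    refine ⟨curveEval q g u₀ v₀ / curveEval q f u₀ v₀, fun t ht => ?_⟩
    rw [le_div_iff₀ hpos]
    exact (hSmem t).mp ht _ _ h₀
  refine ⟨sSup S, le_csSup hbdd h0, hclosed.csSup_mem ⟨0, h0⟩ hbdd, ?_⟩
  rintro ⟨_, c, hc⟩
  have hd : 0 < |c| + 1 := by positivity
  have hmem : sSup S + (|c| + 1)⁻¹ ∈ S := by
    rw [hSmem]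
    intro u v huv
    have h1 := hc u v huv
    have h2 : 0 ≤ curveEval q (g - sSup S • f) u v :=
      (hclosed.csSup_mem ⟨0, h0⟩ hbdd : IsPsd q _) u v huv
    have h3 : curveEval q f u v ≤ (|c| + 1) * curveEval q (g - sSup S • f) u v :=
      (le_abs_self _).trans (h1.trans (mul_le_mul_of_nonneg_right
        ((le_abs_self c).trans (by linarith)) h2))
    rw [curveEval_sub, curveEval_smul] at h3
    have h4 := (inv_mul_le_iff₀ hd).mpr h3
    linarith
  have := le_csSup hbdd hmem
  have : 0 < (|c| + 1)⁻¹ := by positivity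
  linarith

/-- Decomposition of psd elements into extremal ones. -/
theorem IsPsd.induction_extremal (hq : q.Monic) (hdeg : q.natDegree = 4)
    (hindef : ∃ x : ℝ, q.eval x < 0) {Q : CurveRing q → Prop} (hzero : Q 0)
    (hadd : ∀ f g, Q f → Q g → Q (f + g)) (hsmul : ∀ (c : ℝ) f, 0 ≤ c → Q f → Q (c • f))
    (hext : ∀ f, f ≠ 0 → f ∈ deltaLE q k → IsPsd q f →
      (∀ g ∈ dominatedBy q k f, ∃ c : ℝ, g = c • f) → Q f)
    {f : CurveRing q} (hf : IsPsd q f) (hk : f ∈ deltaLE q k) : Q f := by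
  induction hn : Module.finrank ℝ (dominatedBy q k f) using Nat.strong_induction_on
    generalizing f with
  | _ n ih =>
  subst hn
  by_cases hf0 : f = 0
  · rwa [hf0]
  by_cases hE : ∀ g ∈ dominatedBy q k f, ∃ c : ℝ, g = c • f
  · exact hext f hf0 hk hf hE
  push Not at hE
  obtain ⟨g₀, hg₀, hne⟩ := hE
  have hff := self_mem_dominatedBy hk hf
  obtain ⟨c, hc⟩ := hg₀.2
  have hg : IsPsd q (c • f - g₀) := by
    intro u v huv
    change 0 ≤ curveEval q (c • f - g₀) u v
    rw [curveEval_sub, curveEval_smul]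
    have := (le_abs_self _).trans (hc u v huv)
    linarith
  obtain ⟨t, -, hg₁psd, hg₁⟩ := exists_maximal_sub (k := k) hq hdeg hindef hf0 hf hg
  set g₁ := c • f - g₀ - t • f with hg₁def
  have hg₁mem : g₁ ∈ dominatedBy q k f :=
    sub_mem (sub_mem (Submodule.smul_mem _ c hff) hg₀) (Submodule.smul_mem _ t hff)
  have hg₁0 : g₁ ≠ 0 := by
    intro h
    apply hne (c - t)
    rw [sub_smul]
    have : c • f - t • f - g₀ = 0 := by rw [← h, hg₁def]; abel
    exact (sub_eq_zero.mp this).symm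
  obtain ⟨s, hs, hf₁psd, hf₁⟩ := exists_maximal_sub (k := k) hq hdeg hindef hg₁0 hg₁psd hf
  have hf₁mem : f - s • g₁ ∈ dominatedBy q k f := sub_mem hff (Submodule.smul_mem _ s hg₁mem)
  have hlt₁ : dominatedBy q k g₁ < dominatedBy q k f :=
    lt_of_le_of_ne (dominatedBy_mono hg₁psd hg₁mem) fun h => hg₁ (h ▸ hff)
  have hlt₂ : dominatedBy q k (f - s • g₁) < dominatedBy q k f :=
    lt_of_le_of_ne (dominatedBy_mono hf₁psd hf₁mem) fun h => hf₁ (h ▸ hg₁mem)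
  have hQ₁ := ih _ (Submodule.finrank_lt_finrank_of_lt hlt₁) hg₁psd hg₁mem.1 rfl
  have hQ₂ := ih _ (Submodule.finrank_lt_finrank_of_lt hlt₂) hf₁psd hf₁mem.1 rfl
  have := hadd _ _ hQ₂ (hsmul s _ hs hQ₁)
  rwa [sub_add_cancel] at this

end dominated

lemma dvd_rep_of_not_dvd {p q A B : ℝ[X]} (hp : Prime p) (hpq : ¬ p ∣ q)
    (h1 : p ∣ A ^ 2 - q * B ^ 2) (h2 : p ∣ A * B) : p ∣ A ∧ p ∣ B := by
  rcases hp.dvd_or_dvd h2 with h | h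
  · refine ⟨h, ?_⟩
    have : p ∣ q * B ^ 2 := (dvd_sub_right (h.trans (dvd_pow_self A two_ne_zero))).mp h1
    exact hp.dvd_of_dvd_pow ((hp.dvd_or_dvd this).resolve_left hpq)
  · refine ⟨?_, h⟩
    have : p ∣ A ^ 2 :=
      (dvd_sub_left ((h.trans (dvd_pow_self B two_ne_zero)).mul_left q)).mp h1
    exact hp.dvd_of_dvd_pow this

lemma dvd_rep_of_sq_dvd {p q A B : ℝ[X]} (hp : Prime p) (hq : Squarefree q)
    (h1 : p ^ 2 ∣ A ^ 2 - q * B ^ 2) (h2 : p ^ 2 ∣ A * B) : p ∣ A ∧ p ∣ B := by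
  by_cases hA : p ∣ A
  · refine ⟨hA, ?_⟩
    have h : p ^ 2 ∣ q * B ^ 2 := (dvd_sub_right (pow_dvd_pow_of_dvd hA 2)).mp h1
    by_contra hB
    have hB2 : ¬ p ∣ B ^ 2 := fun h => hB (hp.dvd_of_dvd_pow h)
    have := hp.pow_dvd_of_dvd_mul_right 2 hB2 h
    rw [pow_two] at this
    exact hp.not_isUnit (hq p this)
  · exfalso
    have h : p ^ 2 ∣ B := hp.pow_dvd_of_dvd_mul_left 2 hA h2
    have hB : p ∣ B := (dvd_pow_self p two_ne_zero).trans h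
    have : p ∣ A ^ 2 := (dvd_sub_left ((hB.trans (dvd_pow_self B two_ne_zero)).mul_left q)).mp
      ((dvd_pow_self p two_ne_zero).trans h1)
    exact hA (hp.dvd_of_dvd_pow this)

lemma dvd_of_dvd_two_mul {p A : ℝ[X]} (h : p ∣ A + A) : p ∣ A := by
  have : A = C (1 / 2 : ℝ) * (A + A) := by
    rw [← two_mul, ← mul_assoc, ← C_ofNat, ← C_mul]; norm_num
  rw [this]
  exact h.mul_left _

lemma dvd_repA_sq {q p : ℝ[X]} {w : CurveRing q} (h : AdjoinRoot.of (curvePoly q) p ∣ w ^ 2) :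
    p ∣ repA q w ^ 2 - q * repB q w ^ 2 ∧ p ∣ repA q w * repB q w := by
  obtain ⟨h1, h2⟩ := (of_dvd_iff q p _).mp h
  rw [pow_two, repA_mul] at h1
  rw [pow_two, repB_mul, mul_comm (repB q w)] at h2
  exact ⟨by simpa only [pow_two] using h1, dvd_of_dvd_two_mul h2⟩

section curve
variable {q : ℝ[X]} (hq : q.Monic) (hdeg : q.natDegree = 4)
include hq hdeg

/-- The coordinate ring is integrally closed, for denominators in `ℝ[x]`. -/
lemma of_dvd_of_sq_dvd_sq (hsq : Squarefree q) {p : ℝ[X]} {w : CurveRing q}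
    (h : AdjoinRoot.of (curvePoly q) p ^ 2 ∣ w ^ 2) : AdjoinRoot.of (curvePoly q) p ∣ w := by
  induction p using WfDvdMonoid.induction_on_irreducible generalizing w with
  | zero =>
    rw [map_zero, zero_pow two_ne_zero, zero_dvd_iff] at h
    rw [map_zero, zero_dvd_iff]
    by_contra hw
    exact curveRing_mul_ne_zero hq hdeg hw hw (by rw [← pow_two, h])
  | unit p hp => exact (hp.map (AdjoinRoot.of (curvePoly q))).dvd
  | mul p i hp hi ih =>
    have hi2 : AdjoinRoot.of (curvePoly q) (i ^ 2) ∣ w ^ 2 := by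
      rw [map_pow]
      refine dvd_trans ?_ h
      rw [map_mul, mul_pow]
      exact dvd_mul_right _ _
    obtain ⟨h1, h2⟩ := dvd_repA_sq hi2
    obtain ⟨w', rfl⟩ := (of_dvd_iff q i w).mpr (dvd_rep_of_sq_dvd hi.prime hsq h1 h2)
    rw [map_mul]
    refine mul_dvd_mul_left _ (ih ?_)
    obtain ⟨e, he⟩ := h
    refine ⟨e, curveRing_mul_left_cancel hq hdeg (of_ne_zero q (pow_ne_zero 2 hi.ne_zero)) ?_⟩
    rw [map_pow]
    rw [map_mul] at he
    linear_combination he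

end curve

lemma exists_eq_sq_mul_pos {F : ℝ[X]} (hF : F ≠ 0) (hnn : ∀ x, 0 ≤ F.eval x) :
    ∃ n G : ℝ[X], F = n ^ 2 * G ∧ ∀ x, 0 < G.eval x := by
  induction hd : F.natDegree using Nat.strong_induction_on generalizing F with
  | _ d ih =>
  subst hd
  by_cases hpos : ∀ x, 0 < F.eval x
  · exact ⟨1, F, by simp, hpos⟩
  push Not at hpos
  obtain ⟨u, hu⟩ := hpos
  obtain ⟨G, rfl⟩ := sq_dvd_of_nonneg (le_antisymm hu (hnn u)) isOpen_univ (Set.mem_univ u)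
    fun x _ => hnn x
  have hG : G ≠ 0 := right_ne_zero_of_mul hF
  have hGnn : ∀ x, 0 ≤ G.eval x := fun x => by
    refine eval_nonneg_of_eval_ne_zero (P := X - C u) (X_sub_C_ne_zero u) isOpen_univ
      (fun y _ hy => ?_) x (Set.mem_univ x)
    have := hnn y
    rw [eval_mul, eval_pow] at this
    exact nonneg_of_mul_nonneg_right this (by positivity)
  have hlt : G.natDegree < ((X - C u) ^ 2 * G).natDegree := by
    rw [natDegree_mul (pow_ne_zero 2 (X_sub_C_ne_zero u)) hG, natDegree_pow, natDegree_X_sub_C]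
    omega
  obtain ⟨n, H, rfl, hH⟩ := ih _ hlt hG hGnn rfl
  exact ⟨(X - C u) * n, H, by ring, hH⟩

lemma exists_independent_of_dvd {M a b : ℝ[X]} (hM : M ≠ 0) {k : ℕ}
    (hk : M.natDegree + 1 < (k + 1) + (k - 1)) :
    ∃ c ∈ degreeLT ℝ (k + 1), ∃ d ∈ degreeLT ℝ (k - 1), M ∣ d * a - c * b ∧
      ∀ t : ℝ, ¬ (c = t • a ∧ d = t • b) := by
  by_contra! hcon
  let E : degreeLT ℝ (k + 1) × degreeLT ℝ (k - 1) →ₗ[ℝ] ℝ[X] × ℝ[X] :=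
    (degreeLT ℝ (k + 1)).subtype.prodMap (degreeLT ℝ (k - 1)).subtype
  let D : ℝ[X] × ℝ[X] →ₗ[ℝ] ℝ[X] :=
    (LinearMap.mulRight ℝ a).comp (LinearMap.snd ℝ _ _) -
      (LinearMap.mulRight ℝ b).comp (LinearMap.fst ℝ _ _)
  let φ : degreeLT ℝ (k + 1) × degreeLT ℝ (k - 1) →ₗ[ℝ] AdjoinRoot M :=
    ((AdjoinRoot.mkₐ M).toLinearMap.comp D).comp E
  have hEinj : Function.Injective E :=
    Prod.map_injective.mpr ⟨Subtype.val_injective, Subtype.val_injective⟩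
  have i1 : FiniteDimensional ℝ (degreeLT ℝ (k + 1)) :=
    LinearEquiv.finiteDimensional (degreeLTEquiv ℝ (k + 1)).symm
  have i2 : FiniteDimensional ℝ (degreeLT ℝ (k - 1)) :=
    LinearEquiv.finiteDimensional (degreeLTEquiv ℝ (k - 1)).symm
  have i3 : FiniteDimensional ℝ (AdjoinRoot M) := (AdjoinRoot.powerBasis hM).finite
  have hker : LinearMap.ker φ ≤ (Submodule.span ℝ {(a, b)}).comap E := by
    rintro ⟨⟨c, hc⟩, d, hd⟩ h
    have hdvd : M ∣ d * a - c * b := by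
      rw [← AdjoinRoot.mk_eq_zero]; exact h
    obtain ⟨t, h1, h2⟩ := hcon c hc d hd hdvd
    exact Submodule.mem_span_singleton.mpr ⟨t, Prod.ext h1.symm h2.symm⟩
  have h1 : Module.finrank ℝ (LinearMap.ker φ) ≤ 1 := by
    rw [(Submodule.equivMapOfInjective E hEinj (LinearMap.ker φ)).finrank_eq]
    calc _ ≤ Module.finrank ℝ (Submodule.span ℝ {(a, b)}) :=
          Submodule.finrank_mono (Submodule.map_le_iff_le_comap.mpr hker)
      _ ≤ 1 := (finrank_span_le_card _).trans (by simp)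
  have h2 := LinearMap.finrank_range_add_finrank_ker φ
  have h3 : Module.finrank ℝ (LinearMap.range φ) ≤ M.natDegree := by
    refine (Submodule.finrank_le _).trans_eq ?_
    rw [(AdjoinRoot.powerBasis hM).finrank, AdjoinRoot.powerBasis_dim]
  rw [Module.finrank_prod, (degreeLTEquiv ℝ (k + 1)).finrank_eq,
    (degreeLTEquiv ℝ (k - 1)).finrank_eq, Module.finrank_fin_fun, Module.finrank_fin_fun] at h2
  omega

lemma exists_eq_mul_coprime {q : ℝ[X]} {f : CurveRing q} (hf : f ≠ 0) :
    ∃ (P : ℝ[X]) (g : CurveRing q), P ≠ 0 ∧ f = AdjoinRoot.of (curvePoly q) P * g ∧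
      IsCoprime (repA q g) (repB q g) := by
  have hne : GCDMonoid.gcd (repA q f) (repB q f) ≠ 0 := by
    rw [Ne, gcd_eq_zero_iff]
    rintro ⟨hA, hB⟩
    exact hf (curveRing_ext (by simp [hA]) (by simp [hB]))
  refine ⟨_, curveElem q (repA q f / GCDMonoid.gcd (repA q f) (repB q f))
    (repB q f / GCDMonoid.gcd (repA q f) (repB q f)), hne, ?_, ?_⟩
  · refine curveRing_ext ?_ ?_
    · simp [EuclideanDomain.mul_div_cancel' hne (gcd_dvd_left _ _)]
    · simp [EuclideanDomain.mul_div_cancel' hne (gcd_dvd_right _ _)]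
  · rw [repA_curveElem, repB_curveElem]
    exact isCoprime_div_gcd_div_gcd_of_gcd_ne_zero hne

/-- Real-dominated elements arise from divisibility of `g · conj f` by the square part of the
norm of `f`. -/
lemma of_mul_eq_mul_of_dvd {q : ℝ[X]} (hq : q.Monic) (hdeg : q.natDegree = 4)
    {f : CurveRing q} (hcop : IsCoprime (repA q f) (repB q f)) {n G c d : ℝ[X]} (hn : n ≠ 0)
    (hF : curveNorm q f = n ^ 2 * G) (hdvd : n ^ 2 ∣ d * repA q f - c * repB q f) :
    ∃ h : CurveRing q, AdjoinRoot.of (curvePoly q) G * curveElem q c d = h * f := by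
  set a := repA q f with ha
  set b := repB q f with hb
  have hN : a ^ 2 + q * b ^ 2 = n ^ 2 * G := hF
  have hbn : IsCoprime (n ^ 2) b := by
    have h1 : IsCoprime (a ^ 2) b := hcop.pow_left
    have h2 : IsCoprime (n ^ 2 * G) b := by
      rw [← hN, show a ^ 2 + q * b ^ 2 = a ^ 2 + (q * b) * b by ring]
      exact IsCoprime.add_mul_right_left h1 (q * b)
    exact h2.of_mul_left_left
  obtain ⟨t, ht⟩ := hdvd
  have he : n ^ 2 ∣ c * a + q * (d * b) := by
    refine hbn.dvd_of_dvd_mul_right ⟨d * G - a * t, ?_⟩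
    linear_combination d * hN - a * ht
  obtain ⟨e, he⟩ := he
  refine ⟨curveElem q e t, curveRing_mul_left_cancel hq hdeg
    (of_ne_zero q (pow_ne_zero 2 hn)) (curveRing_ext ?_ ?_)⟩
  · simp only [repA_mul, repA_of, repB_of, repA_curveElem, repB_curveElem, repB_mul, ← ha, ← hb]
    linear_combination (-c) * hN + a * he - q * b * ht
  · simp only [repA_mul, repA_of, repB_of, repA_curveElem, repB_curveElem, repB_mul, ← ha, ← hb]
    linear_combination (-d) * hN + b * he + a * ht

section extremal
variable {q : ℝ[X]} (hq : q.Monic) (hdeg : q.natDegree = 4)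
  {k : ℕ} {f : CurveRing q} (hf : f ≠ 0) (hk : f ∈ deltaLE q k) (hpsd : IsPsd q f)
  (hext : ∀ g ∈ dominatedBy q k f, ∃ c : ℝ, g = c • f)
include hq hdeg hf hk hpsd hext

lemma exists_root_of_dvd_extremal {d : ℝ[X]} (hd : 0 < d.natDegree)
    (hdf : AdjoinRoot.of (curvePoly q) d ∣ f) : ∃ u, q.eval u ≤ 0 ∧ d.eval u = 0 := by
  by_contra! hcon
  obtain ⟨g, hg⟩ := hdf
  obtain ⟨ε, hε, hle⟩ := exists_lower_bound hq hdeg hcon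
  have hd0 : d ≠ 0 := by rintro rfl; simp at hd
  have hg0 : g ≠ 0 := by rintro rfl; simp at hg; exact hf hg
  have hδ := curveDelta_mul hq hdeg (of_ne_zero q hd0) hg0
  rw [← hg, curveDelta_of] at hδ
  have hgk : g ∈ deltaLE q k := by
    rw [mem_deltaLE] at hk ⊢; omega
  obtain ⟨c, hc⟩ := hext g ⟨hgk, ε⁻¹, fun u v huv => by
    have hu : q.eval u ≤ 0 := by nlinarith [sq_nonneg v]
    have h1 : curveEval q f u v = |d.eval u| * |curveEval q g u v| := by
      rw [← abs_mul, ← curveEval_of q d u v, ← curveEval_mul _ _ huv, ← hg, abs_of_nonneg]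
      exact hpsd u v huv
    rw [h1, le_inv_mul_iff₀ hε]
    exact mul_le_mul_of_nonneg_right (hle u hu) (abs_nonneg _)⟩
  have hc0 : c ≠ 0 := by rintro rfl; simp at hc; exact hg0 hc
  have hfg : f = c⁻¹ • g := by rw [hc, smul_smul, inv_mul_cancel₀ hc0, one_smul]
  have := curveDelta_smul_le c⁻¹ g
  rw [← hfg] at this
  omega

lemma exists_curveNorm_eq_sq_of_extremal : ∃ n : ℝ[X], curveNorm q f = n ^ 2 ∧ n.natDegree = k := by
  obtain ⟨P, g, hP, hfg, hcop⟩ := exists_eq_mul_coprime hf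
  have hg0 : g ≠ 0 := by rintro rfl; simp at hfg; exact hf hfg
  have hδ := curveDelta_mul hq hdeg (of_ne_zero q hP) hg0
  rw [← hfg, curveDelta_of] at hδ
  have hδk := mem_deltaLE.mp hk
  have hNfg : curveNorm q f = P ^ 2 * curveNorm q g := by rw [hfg, curveNorm_mul, curveNorm_of]
  have hNg : curveNorm q g ≠ 0 := curveNorm_ne_zero hq hdeg hg0
  have hnn : ∀ x, 0 ≤ (curveNorm q g).eval x := fun x => by
    refine eval_nonneg_of_eval_ne_zero hP isOpen_univ (fun y _ hy => ?_) x (Set.mem_univ x)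
    rcases le_total 0 (q.eval y) with hqy | hqy
    · simp only [curveNorm, eval_add, eval_mul, eval_pow]
      positivity
    · have huv : (√(-q.eval y)) ^ 2 + q.eval y = 0 := by
        rw [Real.sq_sqrt (by linarith)]; ring
      have huv' : (-√(-q.eval y)) ^ 2 + q.eval y = 0 := by rw [neg_sq, huv]
      have h1 : 0 ≤ (curveNorm q f).eval y := by
        rw [curveEval_norm f huv]
        exact mul_nonneg (hpsd _ _ huv) (hpsd _ _ huv')
      rw [hNfg, eval_mul, eval_pow] at h1
      exact nonneg_of_mul_nonneg_right h1 (by positivity)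
  obtain ⟨n, G, hnG, hG⟩ := exists_eq_sq_mul_pos hNg hnn
  have hn : n ≠ 0 := by rintro rfl; simp at hnG; exact hNg hnG
  have hG0 : G ≠ 0 := by rintro rfl; simp at hG
  have hge : k ≤ P.natDegree + n.natDegree := by
    by_contra! hlt
    set l := k - P.natDegree with hl
    obtain ⟨c, hc, d, hd, hdvd, hind⟩ := exists_independent_of_dvd (a := repA q g) (b := repB q g)
      (pow_ne_zero 2 hn) (k := l) (by rw [natDegree_pow]; omega)
    obtain ⟨h, hh⟩ := of_mul_eq_mul_of_dvd hq hdeg hcop hn hnG hdvd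
    have hcd : curveDelta q (curveElem q c d) ≤ l :=
      mem_deltaLE.mp ⟨by rwa [repA_curveElem], by rwa [repB_curveElem]⟩
    obtain ⟨K, hK⟩ := exists_bound hq hdeg h
    obtain ⟨ε, hε, hle⟩ := exists_lower_bound hq hdeg (fun u _ => (hG u).ne')
    have hdom : AdjoinRoot.of (curvePoly q) P * curveElem q c d ∈ dominatedBy q k f := by
      constructor
      · rw [mem_deltaLE]
        by_cases h0 : curveElem q c d = 0
        · simp [h0, curveDelta]
        · rw [curveDelta_mul hq hdeg (of_ne_zero q hP) h0, curveDelta_of]; omega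
      · refine ⟨ε⁻¹ * K, fun u v huv => ?_⟩
        have hu : q.eval u ≤ 0 := by nlinarith [sq_nonneg v]
        have hfp : 0 ≤ curveEval q f u v := hpsd u v huv
        have e1 : AdjoinRoot.of (curvePoly q) G *
            (AdjoinRoot.of (curvePoly q) P * curveElem q c d) = h * f := by
          rw [hfg]; linear_combination AdjoinRoot.of (curvePoly q) P * hh
        have e2 : |G.eval u| *
            |curveEval q (AdjoinRoot.of (curvePoly q) P * curveElem q c d) u v| =
            |curveEval q h u v| * curveEval q f u v := by
          rw [← abs_mul, ← curveEval_of q G u v, ← curveEval_mul _ _ huv, e1,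
            curveEval_mul _ _ huv, abs_mul, abs_of_nonneg hfp]
        rw [mul_assoc, le_inv_mul_iff₀ hε]
        calc _ ≤ _ := mul_le_mul_of_nonneg_right (hle u hu) (abs_nonneg _)
          _ = _ := e2
          _ ≤ _ := mul_le_mul_of_nonneg_right (hK u v huv) hfp
    obtain ⟨t, ht⟩ := hext _ hdom
    have hcg : curveElem q c d = t • g := by
      refine curveRing_mul_left_cancel hq hdeg (of_ne_zero q hP) ?_
      rw [ht, hfg, mul_smul_comm]
    refine hind t ⟨?_, ?_⟩
    · have := congrArg (repA q) hcg
      rwa [repA_curveElem, repA_smul, ← smul_eq_C_mul] at this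
    · have := congrArg (repB q) hcg
      rwa [repB_curveElem, repB_smul, ← smul_eq_C_mul] at this
  have hNdeg := natDegree_curveNorm hq hdeg g
  rw [hnG, natDegree_mul (pow_ne_zero 2 hn) hG0, natDegree_pow] at hNdeg
  obtain ⟨c, rfl⟩ := natDegree_eq_zero.mp (show G.natDegree = 0 by omega)
  have hc : 0 < c := by simpa using hG 0
  refine ⟨P * n * C √c, ?_, ?_⟩
  · rw [hNfg, hnG, mul_pow, ← C_pow, Real.sq_sqrt hc.le]; ring
  · rw [natDegree_mul_C (Real.sqrt_pos.mpr hc).ne', natDegree_mul hP hn]; omega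

end extremal

lemma squarefree_of_squarefree_map {q : ℝ[X]}
    (h : Squarefree (q.map (algebraMap ℝ ℂ))) : Squarefree q := by
  intro p hp
  have := h (p.map (algebraMap ℝ ℂ)) (by
    rw [← Polynomial.map_mul]; exact Polynomial.map_dvd _ hp)
  rwa [Polynomial.isUnit_map] at this

lemma dvd_of_squarefree_of_irreducible_dvd {A q : ℝ[X]} (hA0 : A ≠ 0) (hA : Squarefree A)
    (h : ∀ p, Irreducible p → p ∣ A → p ∣ q) : A ∣ q := by
  induction A using WfDvdMonoid.induction_on_irreducible with
  | zero => exact absurd rfl hA0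
  | unit p hp => exact hp.dvd
  | mul p i hp hi ih =>
    have hcop : IsCoprime i p := by
      rw [hi.coprime_iff_not_dvd]
      exact fun hdvd => hi.not_isUnit (hA i (mul_dvd_mul_left i hdvd))
    exact hcop.mul_dvd (h i hi (dvd_mul_right i p))
      (ih hp hA.of_mul_right fun j hj hjp => h j hj (hjp.mul_left i))

lemma exists_of_mul_eq_sq_of_norm_eq_sq {q : ℝ[X]} {m : ℕ} {f : CurveRing q}
    (hk : f ∈ deltaLE q (2 * m)) {n : ℝ[X]} (hn : curveNorm q f = n ^ 2)
    (hnd : n.natDegree = 2 * m) (hn0 : n ≠ 0) :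
    ∃ (A : ℝ[X]) (w : CurveRing q), A ≠ 0 ∧ Even A.natDegree ∧
      AdjoinRoot.of (curvePoly q) A * f = w ^ 2 := by
  have ha : (repA q f).natDegree ≤ 2 * m := by
    have := mem_deltaLE.mp hk
    unfold curveDelta at this
    split_ifs at this
    · exact this
    · exact (le_max_left _ _).trans this
  have key : ∀ n : ℝ[X], curveNorm q f = n ^ 2 → n.natDegree = 2 * m →
      (repA q f + n).coeff (2 * m) ≠ 0 → ∃ (A : ℝ[X]) (w : CurveRing q), A ≠ 0 ∧
        Even A.natDegree ∧ AdjoinRoot.of (curvePoly q) A * f = w ^ 2 := by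
    intro n hn hnd hc
    have hd : (repA q f + n).natDegree = 2 * m :=
      le_antisymm (natDegree_add_le_of_degree_le ha hnd.le) (le_natDegree_of_ne_zero hc)
    have h0 : repA q f + n ≠ 0 := by intro h; rw [h] at hc; simp at hc
    unfold curveNorm at hn
    refine ⟨C 2 * (repA q f + n), curveElem q (repA q f + n) (repB q f),
      mul_ne_zero (by simp) h0, ?_, ?_⟩
    · rw [natDegree_C_mul (by norm_num), hd]; exact even_two_mul m
    · refine curveRing_ext ?_ ?_
      · simp only [pow_two (curveElem _ _ _), repA_mul, repA_of, repB_of, repA_curveElem,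
          repB_curveElem, C_ofNat]
        linear_combination hn
      · simp only [pow_two (curveElem _ _ _), repB_mul, repA_of, repB_of, repA_curveElem,
          repB_curveElem, C_ofNat]
        ring
  by_cases hc : (repA q f + n).coeff (2 * m) = 0
  · refine key (-n) (by rw [hn, neg_sq]) (by rw [natDegree_neg, hnd]) fun hc' => ?_
    rw [coeff_add] at hc
    rw [coeff_add, coeff_neg] at hc'
    have hlc : n.coeff (2 * m) ≠ 0 := by
      rw [← hnd]; exact leadingCoeff_ne_zero.mpr hn0
    exact hlc (by linarith)
  · exact key n hn hnd hc

section curve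
variable {q : ℝ[X]} (hq : q.Monic) (hdeg : q.natDegree = 4)
include hq hdeg

lemma exists_squarefree_of_mul_eq_sq {f : CurveRing q} (hsq : Squarefree q) {A : ℝ[X]}
    {w : CurveRing q} (hA : A ≠ 0) (heven : Even A.natDegree)
    (h : AdjoinRoot.of (curvePoly q) A * f = w ^ 2) :
    ∃ (B : ℝ[X]) (z : CurveRing q), B ≠ 0 ∧ Even B.natDegree ∧ Squarefree B ∧
      AdjoinRoot.of (curvePoly q) B * f = z ^ 2 := by
  induction hd : A.natDegree using Nat.strong_induction_on generalizing A w with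
  | _ d ih =>
  subst hd
  by_cases hAsq : Squarefree A
  · exact ⟨A, w, hA, heven, hAsq, h⟩
  unfold Squarefree at hAsq
  push Not at hAsq
  obtain ⟨x, ⟨B, rfl⟩, hx⟩ := hAsq
  have hB : B ≠ 0 := right_ne_zero_of_mul hA
  have hx0 : x ≠ 0 := left_ne_zero_of_mul (left_ne_zero_of_mul hA)
  obtain ⟨z, rfl⟩ := of_dvd_of_sq_dvd_sq hq hdeg hsq (p := x) (w := w)
    ⟨AdjoinRoot.of (curvePoly q) B * f, by rw [← h, map_mul, map_mul]; ring⟩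
  have hdeg' : (x * x * B).natDegree = 2 * x.natDegree + B.natDegree := by
    rw [natDegree_mul (mul_ne_zero hx0 hx0) hB, natDegree_mul hx0 hx0]; ring
  have hxd : x.natDegree ≠ 0 := fun h0 => by
    obtain ⟨c, rfl⟩ := natDegree_eq_zero.mp h0
    exact hx (isUnit_C.mpr (isUnit_iff_ne_zero.mpr fun hc => hx0 (by rw [hc, C_0])))
  refine ih B.natDegree (by omega) (w := z) hB ?_ ?_ rfl
  · rw [hdeg', Nat.even_add] at heven
    exact heven.mp (even_two_mul _)
  · refine curveRing_mul_left_cancel hq hdeg (of_ne_zero q (pow_ne_zero 2 hx0)) ?_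
    rw [map_mul, map_mul] at h
    rw [map_pow]
    linear_combination h

lemma eval_nonneg_of_mul_eq_sq {f : CurveRing q} (hf : f ≠ 0) (hpsd : IsPsd q f) {A : ℝ[X]}
    {w : CurveRing q} (h : AdjoinRoot.of (curvePoly q) A * f = w ^ 2) :
    ∀ x ∈ {x : ℝ | q.eval x < 0}, 0 ≤ A.eval x := by
  refine eval_nonneg_of_eval_ne_zero (curveNorm_ne_zero hq hdeg hf)
    (isOpen_lt q.continuous continuous_const) fun y hy hne => ?_
  have hy' : q.eval y < 0 := hy
  have huv : (√(-q.eval y)) ^ 2 + q.eval y = 0 := by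
    rw [Real.sq_sqrt (by linarith)]; ring
  rw [curveEval_norm f huv] at hne
  have hpos : 0 < curveEval q f y (√(-q.eval y)) :=
    lt_of_le_of_ne (hpsd _ _ huv) (left_ne_zero_of_mul hne).symm
  have h1 := curveEval_mul (AdjoinRoot.of (curvePoly q) A) f huv
  rw [h, pow_two, curveEval_mul _ _ huv, curveEval_of] at h1
  exact nonneg_of_mul_nonneg_left (h1 ▸ mul_self_nonneg _) hpos

lemma dvd_of_squarefree_of_mul_eq_sq {f : CurveRing q} (hf : f ≠ 0) (hpsd : IsPsd q f)
    (hroot : ∀ d : ℝ[X], 0 < d.natDegree → AdjoinRoot.of (curvePoly q) d ∣ f →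
      ∃ u, q.eval u ≤ 0 ∧ d.eval u = 0)
    {A : ℝ[X]} {w : CurveRing q} (hA0 : A ≠ 0) (hA : Squarefree A)
    (h : AdjoinRoot.of (curvePoly q) A * f = w ^ 2) : A ∣ q := by
  refine dvd_of_squarefree_of_irreducible_dvd hA0 hA fun p hp ⟨B, hB⟩ => ?_
  by_contra hpq
  have hdvd : AdjoinRoot.of (curvePoly q) p ∣ w ^ 2 := by
    rw [← h, hB, map_mul, mul_assoc]; exact dvd_mul_right _ _
  obtain ⟨h1, h2⟩ := dvd_repA_sq hdvd
  obtain ⟨z, rfl⟩ := (of_dvd_iff q p w).mpr (dvd_rep_of_not_dvd hp.prime hpq h1 h2)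
  have hpB : ¬ p ∣ B := fun hpB => hp.not_isUnit (hA p (hB ▸ mul_dvd_mul_left p hpB))
  have h3 : AdjoinRoot.of (curvePoly q) B * f = AdjoinRoot.of (curvePoly q) p * z ^ 2 := by
    refine curveRing_mul_left_cancel hq hdeg (of_ne_zero q hp.ne_zero) ?_
    rw [hB, map_mul] at h
    linear_combination h
  have hpf : AdjoinRoot.of (curvePoly q) p ∣ f := by
    obtain ⟨h4, h5⟩ := (of_dvd_iff q p (AdjoinRoot.of (curvePoly q) B * f)).mp ⟨_, h3⟩
    simp only [repA_mul, repB_mul, repA_of, repB_of, zero_mul, mul_zero, sub_zero,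
      add_zero] at h4 h5
    exact (of_dvd_iff q p f).mpr ⟨(hp.prime.dvd_or_dvd h4).resolve_left hpB,
      (hp.prime.dvd_or_dvd h5).resolve_left hpB⟩
  obtain ⟨u, hu, hpu⟩ := hroot p hp.natDegree_pos hpf
  have hass : Associated (X - C u) p :=
    (irreducible_X_sub_C u).associated_of_dvd hp (dvd_iff_isRoot.mpr hpu)
  have hqu : q.eval u < 0 := lt_of_le_of_ne hu fun h0 =>
    hpq (hass.symm.dvd.trans (dvd_iff_isRoot.mpr h0))
  have := sq_dvd_of_nonneg (A := A) (u := u) (by rw [hB, eval_mul, hpu, zero_mul])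
    (isOpen_lt q.continuous continuous_const) hqu (eval_nonneg_of_mul_eq_sq hq hdeg hf hpsd h)
  rw [pow_two] at this
  exact (irreducible_X_sub_C u).not_isUnit (hA _ this)

end curve

lemma eq_C_or_eq_C_mul_of_dvd {B r : ℝ[X]} (hr : r ≠ 0) (hr2 : r.natDegree = 2) (hB : B ∣ r)
    (heven : Even B.natDegree) : ∃ c : ℝ, c ≠ 0 ∧ (B = C c ∨ B = C c * r) := by
  obtain ⟨D, rfl⟩ := hB
  have hB0 := left_ne_zero_of_mul hr
  have hD0 := right_ne_zero_of_mul hr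
  rw [natDegree_mul hB0 hD0] at hr2
  obtain ⟨j, hj⟩ := heven
  have : B.natDegree = 0 ∨ D.natDegree = 0 := by omega
  rcases this with h | h
  · obtain ⟨c, rfl⟩ := natDegree_eq_zero.mp h
    exact ⟨c, fun hc => hB0 (by rw [hc, C_0]), Or.inl rfl⟩
  · obtain ⟨c, rfl⟩ := natDegree_eq_zero.mp h
    have hc : c ≠ 0 := fun hc => hD0 (by rw [hc, C_0])
    refine ⟨c⁻¹, inv_ne_zero hc, Or.inr ?_⟩
    rw [mul_left_comm, ← C_mul, inv_mul_cancel₀ hc, C_1, mul_one]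

lemma exists_eval_pos_right {r : ℝ[X]} {a b : ℝ} (hab : a < b) (hr : 0 < r.eval a) :
    ∃ x, a < x ∧ x < b ∧ 0 < r.eval x := by
  have h1 : ∀ᶠ x in nhdsWithin a (Set.Ioi a), 0 < r.eval x :=
    (r.continuous.tendsto a).eventually (lt_mem_nhds hr) |>.filter_mono nhdsWithin_le_nhds
  obtain ⟨x, hx, hx'⟩ := (h1.and (Ioo_mem_nhdsGT hab)).exists
  exact ⟨x, hx'.1, hx'.2, hx⟩

lemma exists_eval_pos_left {r : ℝ[X]} {a b : ℝ} (hab : a < b) (hr : 0 < r.eval b) :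
    ∃ x, a < x ∧ x < b ∧ 0 < r.eval x := by
  have h1 : ∀ᶠ x in nhdsWithin b (Set.Iio b), 0 < r.eval x :=
    (r.continuous.tendsto b).eventually (lt_mem_nhds hr) |>.filter_mono nhdsWithin_le_nhds
  obtain ⟨x, hx, hx'⟩ := (h1.and (Ioo_mem_nhdsLT hab)).exists
  exact ⟨x, hx'.1, hx'.2, hx⟩

/-- Splitting off the extreme real roots of `q`. -/
lemma exists_extreme_root_factorization {q : ℝ[X]} (hq : q.Monic) (hdeg : q.natDegree = 4)
    (hsq : Squarefree q) (hindef : ∃ x : ℝ, q.eval x < 0) {α β : ℝ} (hα : q.eval α = 0)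
    (hβ : q.eval β = 0) (hαβ : ∀ x : ℝ, q.eval x = 0 → α ≤ x ∧ x ≤ β) :
    α < β ∧ ∃ r : ℝ[X], q = (X - C α) * (X - C β) * r ∧ r.natDegree = 2 ∧ r ≠ 0 ∧
      0 < r.eval α ∧ 0 < r.eval β ∧ ∀ x, r.eval x = 0 → α < x ∧ x < β := by
  obtain ⟨x₀, hx₀⟩ := hindef
  have hmem := mem_Icc_of_eval_nonpos hq hdeg hαβ hx₀.le
  have hlt : α < β := by
    refine lt_of_le_of_ne (hmem.1.trans hmem.2) fun h => ?_
    have : x₀ = α := le_antisymm (hmem.2.trans h.ge) hmem.1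
    rw [this, hα] at hx₀
    exact lt_irrefl _ hx₀
  obtain ⟨p, hp⟩ := dvd_iff_isRoot.mpr hα
  have hpβ : p.eval β = 0 := by
    rw [hp, eval_mul, eval_sub, eval_X, eval_C] at hβ
    exact (mul_eq_zero.mp hβ).resolve_left (by linarith)
  obtain ⟨r, rfl⟩ := dvd_iff_isRoot.mpr hpβ
  rw [← mul_assoc] at hp
  have hmon : ((X - C α) * (X - C β)).Monic := (monic_X_sub_C α).mul (monic_X_sub_C β)
  have hr : r.Monic := hmon.of_mul_monic_left (hp ▸ hq)
  have hrd : r.natDegree = 2 := by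
    have h := hdeg
    rw [hp, hmon.natDegree_mul hr, (monic_X_sub_C α).natDegree_mul (monic_X_sub_C β),
      natDegree_X_sub_C, natDegree_X_sub_C] at h
    omega
  have hroot : ∀ x, r.eval x = 0 → q.eval x = 0 := fun x hx => by
    rw [hp, eval_mul, hx, mul_zero]
  have hne : ∀ a, (X - C a) ∣ (X - C α) * (X - C β) → r.eval a ≠ 0 := fun a hdvd h0 =>
    (irreducible_X_sub_C a).not_isUnit (hsq _ (hp ▸ mul_dvd_mul hdvd (dvd_iff_isRoot.mpr h0)))
  have hneα := hne α (dvd_mul_right _ _)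
  have hneβ := hne β (dvd_mul_left _ _)
  refine ⟨hlt, r, hp, hrd, hr.ne_zero, ?_, ?_, fun x hx => ?_⟩
  · by_contra! hle
    obtain ⟨y, hy, hy0⟩ := exists_root_le hr (by omega) (by rw [hrd]; decide) hle
    have : y = α := le_antisymm hy (hαβ y (hroot y hy0)).1
    exact hneα (this ▸ hy0)
  · by_contra! hle
    obtain ⟨y, hy, hy0⟩ := exists_root_ge (by rw [hr.leadingCoeff]; exact one_pos) (by omega) hle
    have : y = β := le_antisymm (hαβ y (hroot y hy0)).2 hy
    exact hneβ (this ▸ hy0)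
  · have h := hαβ x (hroot x hx)
    exact ⟨lt_of_le_of_ne h.1 fun e => hneα (e ▸ hx), lt_of_le_of_ne h.2 fun e => hneβ (e ▸ hx)⟩

lemma no_odd_linear_factor {q r B : ℝ[X]} {α β a b : ℝ} (hlt : α < β)
    (hqr : q = (X - C α) * (X - C β) * r) (hrd : r.natDegree = 2)
    (hr0 : r ≠ 0) (hrα : 0 < r.eval α) (hrβ : 0 < r.eval β)
    (hroot : ∀ x, r.eval x = 0 → α < x ∧ x < β) (hab : a = α ∧ b = β ∨ a = β ∧ b = α)
    (hdvd : (X - C a) * B ∣ q) (hAb : ((X - C a) * B).eval b ≠ 0)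
    (heven : Even ((X - C a) * B).natDegree)
    (hnn : ∀ x ∈ {x : ℝ | q.eval x < 0}, 0 ≤ ((X - C a) * B).eval x) : False := by
  have hB0 : B ≠ 0 := by rintro rfl; simp at hAb
  have hBr : B ∣ r := by
    have h1 : (X - C a) * B ∣ (X - C a) * ((X - C b) * r) := by
      convert hdvd using 1
      rw [hqr]
      rcases hab with ⟨rfl, rfl⟩ | ⟨rfl, rfl⟩ <;> ring
    have h2 := (mul_dvd_mul_iff_left (X_sub_C_ne_zero a)).mp h1
    refine IsCoprime.dvd_of_dvd_mul_left ?_ h2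
    rw [isCoprime_comm, (irreducible_X_sub_C b).coprime_iff_not_dvd, dvd_iff_isRoot]
    intro h
    rw [IsRoot] at h
    exact hAb (by rw [eval_mul, h, mul_zero])
  have hBd : B.natDegree = 1 := by
    have h1 := natDegree_le_of_dvd hBr hr0
    rw [natDegree_mul (X_sub_C_ne_zero a) hB0, natDegree_X_sub_C] at heven
    obtain ⟨j, hj⟩ := heven
    omega
  obtain ⟨γ, hγ⟩ := exists_root_of_degree_eq_one
    (by rw [degree_eq_natDegree hB0, hBd]; rfl : B.degree = 1)
  obtain ⟨hαγ, hγβ⟩ := hroot γ (by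
    obtain ⟨D, rfl⟩ := hBr
    rw [eval_mul, hγ, zero_mul])
  obtain ⟨D, rfl⟩ := dvd_iff_isRoot.mpr hγ
  have hD0 := right_ne_zero_of_mul hB0
  have hDd : D.natDegree = 0 := by
    rw [natDegree_mul (X_sub_C_ne_zero γ) hD0, natDegree_X_sub_C] at hBd; omega
  obtain ⟨c, rfl⟩ := natDegree_eq_zero.mp hDd
  have hc : c ≠ 0 := fun hc => hD0 (by rw [hc, C_0])
  have hneg : ∀ x, α < x → x < β → 0 < r.eval x → 0 ≤ (x - a) * ((x - γ) * c) := by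
    intro x h1 h2 h3
    have : q.eval x < 0 := by
      rw [hqr]
      simp only [eval_mul, eval_sub, eval_X, eval_C]
      exact mul_neg_of_neg_of_pos (mul_neg_of_pos_of_neg (by linarith) (by linarith)) h3
    simpa using hnn x this
  obtain ⟨x, hx1, hx2, hx3⟩ := exists_eval_pos_right hαγ hrα
  obtain ⟨y, hy1, hy2, hy3⟩ := exists_eval_pos_left hγβ hrβ
  have hx := hneg x hx1 (hx2.trans hγβ) hx3
  have hy := hneg y (hαγ.trans hy1) hy2 hy3
  have hxy : ((x - a) * (x - γ)) * ((y - a) * (y - γ)) < 0 := by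
    have e : ((x - a) * (x - γ)) * ((y - a) * (y - γ)) =
      ((x - a) * (y - a)) * ((x - γ) * (y - γ)) := by ring
    rw [e]
    refine mul_neg_of_pos_of_neg ?_ (mul_neg_of_neg_of_pos (by linarith) (by linarith))
    rcases hab with ⟨rfl, -⟩ | ⟨rfl, -⟩
    · exact mul_pos (by linarith) (by linarith)
    · exact mul_pos_of_neg_of_neg (by linarith) (by linarith)
  have hc2 : 0 < c ^ 2 := by positivity
  nlinarith [mul_nonneg hx hy, mul_pos_of_neg_of_neg hxy (neg_neg_of_pos hc2)]

lemma of_eq_neg_y_sq (q : ℝ[X]) : AdjoinRoot.of (curvePoly q) q = -(curveElem q 0 1) ^ 2 := by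
  rw [eq_neg_iff_add_eq_zero, of_eq_curveElem, pow_two, curveElem_mul]
  refine curveRing_ext ?_ ?_ <;> simp

lemma square_or_mul_square {q : ℝ[X]} (hq : q.Monic) (hdeg : q.natDegree = 4)
    (hsq : Squarefree q) (hindef : ∃ x : ℝ, q.eval x < 0) {α β : ℝ} (hα : q.eval α = 0)
    (hβ : q.eval β = 0) (hαβ : ∀ x : ℝ, q.eval x = 0 → α ≤ x ∧ x ≤ β) {f w : CurveRing q}
    {A : ℝ[X]} (heven : Even A.natDegree) (hA : Squarefree A) (hAq : A ∣ q)
    (hnn : ∀ x ∈ {x : ℝ | q.eval x < 0}, 0 ≤ A.eval x)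
    (h : AdjoinRoot.of (curvePoly q) A * f = w ^ 2) :
    ∃ (c : ℝ) (k : CurveRing q), 0 < c ∧ (AdjoinRoot.of (curvePoly q) (C c) * f = k ^ 2 ∨
      AdjoinRoot.of (curvePoly q) (C c * ((X - C α) * (C β - X))) * f = k ^ 2) := by
  obtain ⟨hlt, r, hqr, hrd, hr0, hrα, hrβ, hroot⟩ :=
    exists_extreme_root_factorization hq hdeg hsq hindef hα hβ hαβ
  obtain ⟨x₀, hx₀⟩ := hindef
  have hA₀ := hnn x₀ hx₀
  have hmem := mem_Icc_of_eval_nonpos hq hdeg hαβ hx₀.le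
  have hx₀s : 0 < (x₀ - α) * (β - x₀) := by
    refine mul_pos (sub_pos.mpr (lt_of_le_of_ne hmem.1 ?_))
      (sub_pos.mpr (lt_of_le_of_ne hmem.2 ?_))
    · rintro rfl; rw [hα] at hx₀; exact lt_irrefl _ hx₀
    · rintro rfl; rw [hβ] at hx₀; exact lt_irrefl _ hx₀
  have hx₀r : 0 < r.eval x₀ := by
    rw [hqr] at hx₀
    simp only [eval_mul, eval_sub, eval_X, eval_C] at hx₀
    by_contra! hle
    nlinarith
  have hq0 := hq.ne_zero
  have hy := of_eq_neg_y_sq q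
  have hdivide : ∀ (t : CurveRing q) (z : CurveRing q),
      AdjoinRoot.of (curvePoly q) q ^ 2 * t = z ^ 2 → ∃ k, t = k ^ 2 := by
    intro t z htz
    obtain ⟨k, rfl⟩ := of_dvd_of_sq_dvd_sq hq hdeg hsq (p := q) ⟨t, htz.symm⟩
    refine ⟨k, curveRing_mul_left_cancel hq hdeg (of_ne_zero q (pow_ne_zero 2 hq0)) ?_⟩
    rw [map_pow]
    linear_combination htz
  by_cases hAα : A.eval α = 0
  · obtain ⟨B, rfl⟩ := dvd_iff_isRoot.mpr hAα
    by_cases hBβ : ((X - C α) * B).eval β = 0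
    · have hB : B.eval β = 0 := by
        rw [eval_mul, eval_sub, eval_X, eval_C] at hBβ
        exact (mul_eq_zero.mp hBβ).resolve_left (by linarith)
      obtain ⟨D, rfl⟩ := dvd_iff_isRoot.mpr hB
      have hs0 : (X - C α) * (X - C β) ≠ 0 :=
        mul_ne_zero (X_sub_C_ne_zero α) (X_sub_C_ne_zero β)
      have hD0 : D ≠ 0 := by
        rintro rfl
        rw [mul_zero, mul_zero, zero_dvd_iff] at hAq
        exact hq0 hAq
      have hDr : D ∣ r := by
        rw [hqr, ← mul_assoc] at hAq
        exact (mul_dvd_mul_iff_left hs0).mp hAq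
      have hDe : Even D.natDegree := by
        rw [natDegree_mul (X_sub_C_ne_zero α) (mul_ne_zero (X_sub_C_ne_zero β) hD0),
          natDegree_mul (X_sub_C_ne_zero β) hD0, natDegree_X_sub_C, natDegree_X_sub_C] at heven
        obtain ⟨j, hj⟩ := heven
        exact ⟨j - 1, by omega⟩
      obtain ⟨c, hc, rfl | rfl⟩ := eq_C_or_eq_C_mul_of_dvd hr0 hrd hDr hDe
      · simp only [eval_mul, eval_sub, eval_X, eval_C] at hA₀
        refine ⟨-c, w, ?_, Or.inr ?_⟩
        · rcases lt_or_gt_of_ne hc with hc | hc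
          · linarith
          · nlinarith
        · rw [← h]
          congr 2
          rw [C_neg]; ring
      · simp only [eval_mul, eval_sub, eval_X, eval_C] at hA₀
        have hcneg : 0 < -c := by
          rcases lt_or_gt_of_ne hc with hc | hc
          · linarith
          · have := mul_pos (mul_pos hx₀s hx₀r) hc
            nlinarith
        have e : (X - C α) * ((X - C β) * (C c * r)) = C c * q := by rw [hqr]; ring
        rw [e, map_mul] at h
        obtain ⟨k, hk⟩ := hdivide (AdjoinRoot.of (curvePoly q) (C (-c)) * f)
          (curveElem q 0 1 * w) (by
            rw [C_neg, map_neg]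
            linear_combination (curveElem q 0 1) ^ 2 * h -
              AdjoinRoot.of (curvePoly q) (C c) * f * AdjoinRoot.of (curvePoly q) q * hy)
        exact ⟨-c, k, hcneg, Or.inl hk⟩
    · exact (no_odd_linear_factor hlt hqr hrd hr0 hrα hrβ hroot (Or.inl ⟨rfl, rfl⟩) hAq hBβ
        heven hnn).elim
  · by_cases hAβ : A.eval β = 0
    · obtain ⟨B, rfl⟩ := dvd_iff_isRoot.mpr hAβ
      exact (no_odd_linear_factor hlt hqr hrd hr0 hrα hrβ hroot (Or.inr ⟨rfl, rfl⟩) hAq hAα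
        heven hnn).elim
    · have hcop : ∀ a, A.eval a ≠ 0 → IsCoprime A (X - C a) := fun a ha => by
        rw [isCoprime_comm, (irreducible_X_sub_C a).coprime_iff_not_dvd, dvd_iff_isRoot]
        exact ha
      have hAr : A ∣ r := by
        rw [hqr] at hAq
        exact ((hcop α hAα).mul_right (hcop β hAβ)).dvd_of_dvd_mul_left hAq
      obtain ⟨c, hc, rfl | rfl⟩ := eq_C_or_eq_C_mul_of_dvd hr0 hrd hAr heven
      · rw [eval_C] at hA₀
        exact ⟨c, w, lt_of_le_of_ne hA₀ hc.symm, Or.inl h⟩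
      · rw [eval_mul, eval_C] at hA₀
        have hcpos : 0 < c := by
          rcases lt_or_gt_of_ne hc with hc | hc
          · nlinarith
          · exact hc
        set s : ℝ[X] := (X - C α) * (C β - X) with hs
        have hsr : AdjoinRoot.of (curvePoly q) q =
            -(AdjoinRoot.of (curvePoly q) s * AdjoinRoot.of (curvePoly q) r) := by
          rw [← map_mul, ← map_neg]; congr 1; rw [hqr, hs]; ring
        rw [map_mul] at h
        obtain ⟨k, hk⟩ := hdivide (AdjoinRoot.of (curvePoly q) (C c * s) * f)
          (curveElem q 0 1 * AdjoinRoot.of (curvePoly q) s * w) (by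
            rw [map_mul]
            set cc := AdjoinRoot.of (curvePoly q) (C c)
            set ss := AdjoinRoot.of (curvePoly q) s
            linear_combination (curveElem q 0 1) ^ 2 * ss ^ 2 * h +
              cc * ss * f * AdjoinRoot.of (curvePoly q) q * hy -
              cc * ss * f * (curveElem q 0 1) ^ 2 * hsr)
        exact ⟨c, k, hcpos, Or.inr hk⟩

lemma eval_repA_eq_zero_of_sum_sq {q : ℝ[X]} {a : ℝ} (ha : q.eval a = 0) {p : ℝ[X]}
    (hp : p.eval a = 0) {r : ℕ} {g : Fin r → CurveRing q}
    (h : AdjoinRoot.of (curvePoly q) p = ∑ i, g i ^ 2) (i : Fin r) :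
    (repA q (g i)).eval a = 0 := by
  have hsum : ∀ s : Finset (Fin r),
      curveEval q (∑ j ∈ s, g j ^ 2) a 0 = ∑ j ∈ s, (repA q (g j)).eval a ^ 2 := by
    intro s
    induction s using Finset.induction_on with
    | empty => simpa using curveEval_of q 0 a 0
    | insert j s hj ih =>
      rw [Finset.sum_insert hj, Finset.sum_insert hj, curveEval_add, ih, pow_two (g j),
        curveEval_mul _ _ (by rw [ha]; norm_num)]
      simp [curveEval, pow_two]
  have h0 := hsum Finset.univ
  rw [← h, curveEval_of, hp] at h0
  have := (Finset.sum_eq_zero_iff_of_nonneg fun j _ => sq_nonneg _).mp h0.symm i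
    (Finset.mem_univ i)
  exact pow_eq_zero_iff two_ne_zero |>.mp this

/-- Every term of a representation of `(x - α)(β - x)` as a sum of squares vanishes at the two
branch points over `α` and `β`. -/
lemma of_dvd_sq_of_sum_sq {q : ℝ[X]} {α β : ℝ} (hlt : α ≠ β)
    (hdvd : (X - C α) * (C β - X) ∣ q) {r : ℕ} {g : Fin r → CurveRing q}
    (h : AdjoinRoot.of (curvePoly q) ((X - C α) * (C β - X)) = ∑ i, g i ^ 2) (i : Fin r) :
    AdjoinRoot.of (curvePoly q) ((X - C α) * (C β - X)) ∣ g i ^ 2 := by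
  have hroot : ∀ a, ((X - C α) * (C β - X)).eval a = 0 → (repA q (g i)).eval a = 0 := by
    intro a ha
    refine eval_repA_eq_zero_of_sum_sq ?_ ha h i
    obtain ⟨t, rfl⟩ := hdvd
    rw [eval_mul, ha, zero_mul]
  have hA : (X - C α) * (C β - X) ∣ repA q (g i) := by
    rw [← neg_sub X (C β), mul_neg, neg_dvd]
    exact (isCoprime_X_sub_C_of_isUnit_sub (sub_ne_zero.mpr hlt).isUnit).mul_dvd
      (dvd_iff_isRoot.mpr (hroot α (by simp))) (dvd_iff_isRoot.mpr (hroot β (by simp)))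
  rw [of_dvd_iff, pow_two, repA_mul, repB_mul]
  exact ⟨dvd_sub (hA.mul_right _) (hdvd.mul_right _),
    dvd_add (hA.mul_right _) (hA.mul_left _)⟩

section main

variable {q : ℝ[X]} (hq : q.Monic) (hdeg : q.natDegree = 4)
include hq hdeg

lemma two_mul_curveDelta_of_mul_eq_sq {f k : CurveRing q} {p : ℝ[X]}
    (hp : p ≠ 0) (hf : f ≠ 0) (h : AdjoinRoot.of (curvePoly q) p * f = k ^ 2) :
    k ≠ 0 ∧ 2 * curveDelta q k = p.natDegree + curveDelta q f := by
  have hk : k ≠ 0 := by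
    rintro rfl
    rw [zero_pow two_ne_zero] at h
    exact curveRing_mul_ne_zero hq hdeg (of_ne_zero q hp) hf h
  refine ⟨hk, ?_⟩
  have h' := congrArg (curveDelta q) h
  rw [curveDelta_mul hq hdeg (of_ne_zero q hp) hf, curveDelta_of, pow_two,
    curveDelta_mul hq hdeg hk hk] at h'
  omega

lemma isSosLe_of_mul_eq_sq (hsq : Squarefree q) {α β : ℝ} (hlt : α ≠ β)
    (hdvd : (X - C α) * (C β - X) ∣ q) {N m : ℕ}
    (hsos : IsSosLe q (AdjoinRoot.of (curvePoly q) ((X - C α) * (C β - X))) N)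
    {f k : CurveRing q} (hf : f ≠ 0) (hδ : curveDelta q f ≤ 2 * m)
    (h : AdjoinRoot.of (curvePoly q) ((X - C α) * (C β - X)) * f = k ^ 2) :
    IsSosLe q f (N - 1 + m) := by
  obtain ⟨r, g, hg, hN⟩ := hsos
  have hterm := of_dvd_sq_of_sum_sq hlt hdvd hg
  have hsd : ((X - C α) * (C β - X)).natDegree = 2 := by
    rw [← neg_sub X (C β), mul_neg, natDegree_neg,
      (monic_X_sub_C α).natDegree_mul (monic_X_sub_C β), natDegree_X_sub_C, natDegree_X_sub_C]
  set s : ℝ[X] := (X - C α) * (C β - X)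
  have hs0 : s ≠ 0 := by intro h0; rw [h0] at hsd; simp at hsd
  obtain ⟨hk, hkδ⟩ := two_mul_curveDelta_of_mul_eq_sq hq hdeg hs0 hf h
  have hdiv : ∀ i, AdjoinRoot.of (curvePoly q) s ∣ k * g i := fun i => by
    refine of_dvd_of_sq_dvd_sq hq hdeg hsq ?_
    obtain ⟨t, ht⟩ := hterm i
    exact ⟨f * t, by rw [mul_pow, ← h, ht]; ring⟩
  choose b hb using hdiv
  refine ⟨r, b, ?_, fun i => ?_⟩
  · refine curveRing_mul_left_cancel hq hdeg (of_ne_zero q (pow_ne_zero 2 hs0)) ?_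
    rw [map_pow, Finset.mul_sum]
    simp_rw [← mul_pow, ← hb, mul_pow, ← Finset.mul_sum, ← hg, ← h]
    ring
  · by_cases hb0 : b i = 0
    · simp [hb0, curveDelta]
    have hg0 : g i ≠ 0 := fun h0 => by
      have := hb i
      rw [h0, mul_zero] at this
      exact curveRing_mul_ne_zero hq hdeg (of_ne_zero q hs0) hb0 this.symm
    have h' := congrArg (curveDelta q) (hb i)
    rw [curveDelta_mul hq hdeg hk hg0, curveDelta_mul hq hdeg (of_ne_zero q hs0) hb0,
      curveDelta_of, hsd] at h'
    have := hN i
    omega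

end main

/-- Corollary 2.13 / `corthmsum`: if `(x−α)(β−x)` is a sum of squares
of elements of `δ`-degree `≤ N` (with `N ≥ 2`), then every nonzero psd `f ∈ ℝ[C]`
satisfies `θ(f) ≤ N − 1 + ⌈δ(f)/2⌉`. -/
theorem stability_bound_from_stability_constant
    (q : Polynomial ℝ) (hmonic : q.Monic) (hdeg : q.natDegree = 4)
    (hsep : Squarefree (q.map (algebraMap ℝ ℂ)))
    (hindef : ∃ x : ℝ, q.eval x < 0)
    (α β : ℝ) (hα : q.eval α = 0) (hβ : q.eval β = 0)
    (hαβ : ∀ x : ℝ, q.eval x = 0 → α ≤ x ∧ x ≤ β)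
    (N : ℕ) (hN : 2 ≤ N)
    (hsos : IsSosLe q (AdjoinRoot.of (curvePoly q) ((X - C α) * (C β - X))) N) :
    ∀ f : CurveRing q, f ≠ 0 → IsPsd q f →
      curveTheta q f ≤ ((N - 1 + (curveDelta q f + 1) / 2 : ℕ) : ℕ∞) := by
  intro f _ hpsd
  refine sInf_le ⟨_, rfl, ?_⟩
  generalize hm : (curveDelta q f + 1) / 2 = m
  have hfm : f ∈ deltaLE q (2 * m) := mem_deltaLE.mpr (by omega)
  have hsq := squarefree_of_squarefree_map hsep
  obtain ⟨hlt, r, hqr, -⟩ :=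
    exists_extreme_root_factorization hmonic hdeg hsq hindef hα hβ hαβ
  have hdvd : (X - C α) * (C β - X) ∣ q := ⟨-r, by rw [hqr]; ring⟩
  refine hpsd.induction_extremal hmonic hdeg hindef (Q := fun f => IsSosLe q f (N - 1 + m))
    isSosLe_zero (fun _ _ => IsSosLe.add) (fun _ _ => IsSosLe.smul) ?_ hfm
  intro f hf hfk hpsd hext
  obtain ⟨n, hn, hnd⟩ := exists_curveNorm_eq_sq_of_extremal hmonic hdeg hf hfk hpsd hext
  have hn0 : n ≠ 0 := by
    rintro rfl
    exact curveNorm_ne_zero hmonic hdeg hf (by rw [hn, zero_pow two_ne_zero])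
  obtain ⟨A', w', hA', heven', h'⟩ := exists_of_mul_eq_sq_of_norm_eq_sq hfk hn hnd hn0
  obtain ⟨A, w, hA, heven, hAsq, h⟩ :=
    exists_squarefree_of_mul_eq_sq hmonic hdeg hsq hA' heven' h'
  obtain ⟨c, k, hc, hk⟩ := square_or_mul_square hmonic hdeg hsq hindef hα hβ hαβ heven hAsq
    (dvd_of_squarefree_of_mul_eq_sq hmonic hdeg hf hpsd
      (fun _ hd hdf => exists_root_of_dvd_extremal hmonic hdeg hf hfk hpsd hext hd hdf)
      hA hAsq h)
    (eval_nonneg_of_mul_eq_sq hmonic hdeg hf hpsd h) h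
  have hcf : c⁻¹ • (c • f) = f := inv_smul_smul₀ hc.ne' f
  rw [← hcf]
  refine IsSosLe.smul (inv_nonneg.mpr hc.le) ?_
  have hδ : curveDelta q (c • f) ≤ 2 * m :=
    (curveDelta_smul_le c f).trans (mem_deltaLE.mp hfk)
  have hcf0 : c • f ≠ 0 := fun h0 => hf (by rw [← hcf, h0, smul_zero])
  rcases hk with hk | hk
  · obtain ⟨-, hkδ⟩ := two_mul_curveDelta_of_mul_eq_sq hmonic hdeg (C_ne_zero.mpr hc.ne') hf hk
    refine ⟨1, fun _ => k, ?_, fun _ => ?_⟩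
    · rw [smul_eq_of_mul, hk]; simp
    · have := mem_deltaLE.mp hfk
      rw [natDegree_C] at hkδ
      change curveDelta q k ≤ _
      omega
  · refine isSosLe_of_mul_eq_sq hmonic hdeg hsq hlt.ne hdvd hsos hcf0 hδ (k := k) ?_
    rw [smul_eq_of_mul, ← hk, map_mul _ (C c)]
    ring

end
end

section
/- Let f₀ = (x − α)(x − β) ∈ ℝ[x] and let h₀ ∈ ℝ[x] be the monic quadratic polynomial with q = f₀·h₀. For every integer m ≥ 2, one has θ((x − α)(β − x)) ≤ m (computed in ℝ[C]) if and only if there exist sums of squares s, t in ℝ[x] with deg s = deg t ≤ 2(m − 2) and t·h₀ − s·f₀ = 1. Consequently, if d is the smallest integer for which such s, t of degree ≤ d exist, then θ((x − α)(β − x)) = 2 + d/2. -/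
open Polynomial

noncomputable section

/-- A univariate real polynomial is a sum of squares. -/
def IsSosPoly (p : Polynomial ℝ) : Prop :=
  ∃ (r : ℕ) (g : Fin r → Polynomial ℝ), p = ∑ i, g i ^ 2

/-- There are sums of squares `s, t ∈ ℝ[x]` with `deg s = deg t ≤ d` and
`t·h₀ − s·f₀ = 1`. -/
def HasSosCertificate (f₀ h₀ : Polynomial ℝ) (d : ℕ) : Prop :=
  ∃ s t : Polynomial ℝ, IsSosPoly s ∧ IsSosPoly t ∧ s.natDegree = t.natDegree ∧
    t.natDegree ≤ d ∧ t * h₀ - s * f₀ = 1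

lemma curveRep_of_add_of_mul_root (q a b : ℝ[X]) :
    curveRep q (AdjoinRoot.of (curvePoly q) a +
      AdjoinRoot.of (curvePoly q) b * AdjoinRoot.root (curvePoly q)) = C a + C b * X := by
  have h : AdjoinRoot.of (curvePoly q) a +
      AdjoinRoot.of (curvePoly q) b * AdjoinRoot.root (curvePoly q) =
      AdjoinRoot.mk (curvePoly q) (C a + C b * X) := by
    simp
  rw [h, curveRep, AdjoinRoot.modByMonicHom_mk,
    modByMonic_eq_self_iff (curvePoly_monic q), curvePoly, degree_X_pow_add_C (by norm_num),
    add_comm]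
  exact degree_linear_le.trans_lt (by norm_num)

lemma repA_of_add_of_mul_root (q a b : ℝ[X]) :
    repA q (AdjoinRoot.of (curvePoly q) a +
      AdjoinRoot.of (curvePoly q) b * AdjoinRoot.root (curvePoly q)) = a := by
  simp [repA, curveRep_of_add_of_mul_root]

lemma repB_of_add_of_mul_root (q a b : ℝ[X]) :
    repB q (AdjoinRoot.of (curvePoly q) a +
      AdjoinRoot.of (curvePoly q) b * AdjoinRoot.root (curvePoly q)) = b := by
  simp [repB, curveRep_of_add_of_mul_root]

lemma of_repA_add_of_repB_mul_root (q : ℝ[X]) (f : CurveRing q) :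
    AdjoinRoot.of (curvePoly q) (repA q f) +
      AdjoinRoot.of (curvePoly q) (repB q f) * AdjoinRoot.root (curvePoly q) = f := by
  have hdeg : (curveRep q f).degree ≤ 1 := by
    obtain ⟨p, rfl⟩ := AdjoinRoot.mk_surjective f
    have h := degree_modByMonic_lt p (curvePoly_monic q)
    rw [curvePoly, degree_X_pow_add_C (by norm_num)] at h
    rw [curveRep, AdjoinRoot.modByMonicHom_mk]
    exact Order.le_of_lt_succ h
  have h := AdjoinRoot.mk_leftInverse (curvePoly_monic q) f
  change AdjoinRoot.mk (curvePoly q) (curveRep q f) = f at h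
  conv_rhs => rw [← h, eq_X_add_C_of_degree_le_one hdeg]
  simp [repA, repB, add_comm]

lemma root_curvePoly_sq (q : ℝ[X]) :
    AdjoinRoot.root (curvePoly q) ^ 2 = -AdjoinRoot.of (curvePoly q) q := by
  have h : eval₂ (AdjoinRoot.of (curvePoly q)) (AdjoinRoot.root (curvePoly q)) (X ^ 2 + C q) = 0 :=
    AdjoinRoot.eval₂_root (curvePoly q)
  rw [eval₂_add, eval₂_X_pow, eval₂_C] at h
  exact eq_neg_of_add_eq_zero_left h

lemma exists_natDegree_sum_sq {r : ℕ} (g : Fin r → ℝ[X]) :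
    ∃ N : ℕ, (∑ i, g i ^ 2).natDegree = 2 * N ∧ ∀ i, (g i).natDegree ≤ N := by
  set N := Finset.univ.sup fun i => (g i).natDegree with hN
  have hle : ∀ i, (g i).natDegree ≤ N := fun i =>
    Finset.le_sup (f := fun i => (g i).natDegree) (Finset.mem_univ i)
  have hub : (∑ i, g i ^ 2).natDegree ≤ 2 * N :=
    natDegree_sum_le_of_forall_le _ _ fun i _ =>
      natDegree_pow_le.trans (Nat.mul_le_mul_left 2 (hle i))
  refine ⟨N, le_antisymm hub ?_, hle⟩
  rcases Nat.eq_zero_or_pos N with h0 | hpos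
  · simp [h0]
  have hne : (Finset.univ : Finset (Fin r)).Nonempty := by
    rw [Finset.nonempty_iff_ne_empty]
    intro h
    simp [h] at hN
    omega
  obtain ⟨i, -, hi⟩ := Finset.exists_mem_eq_sup _ hne fun i => (g i).natDegree
  have hi' : N = (g i).natDegree := hi
  apply le_natDegree_of_ne_zero
  rw [finsetSum_coeff]
  simp_rw [coeff_pow_of_natDegree_le (hle _)]
  refine (Finset.sum_pos' (fun j _ => sq_nonneg _) ⟨i, Finset.mem_univ i, ?_⟩).ne'
  have hgi : g i ≠ 0 := by
    rintro h
    simp [h] at hi'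
    omega
  have : (g i).coeff N ≠ 0 := by
    rw [hi']
    exact leadingCoeff_ne_zero.mpr hgi
  positivity

lemma IsSosLe.mono {q : ℝ[X]} {f : CurveRing q} {m n : ℕ} (hmn : m ≤ n)
    (h : IsSosLe q f m) : IsSosLe q f n := by
  obtain ⟨r, g, hf, hg⟩ := h
  exact ⟨r, g, hf, fun i => (hg i).trans hmn⟩

lemma curveTheta_le_iff (q : ℝ[X]) (f : CurveRing q) (m : ℕ) :
    curveTheta q f ≤ m ↔ IsSosLe q f m := by
  constructor
  · intro h
    have hlt : curveTheta q f < ((m + 1 : ℕ) : ℕ∞) :=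
      h.trans_lt (by exact_mod_cast Nat.lt_succ_self m)
    obtain ⟨_, ⟨n, rfl, hn⟩, hnm⟩ := sInf_lt_iff.mp hlt
    exact hn.mono (Nat.lt_succ_iff.mp (by exact_mod_cast hnm))
  · exact fun h => sInf_le ⟨m, rfl, h⟩

lemma curveDelta_of_add_of_mul_root_le {q a b : ℝ[X]} {m : ℕ} (ha : a.natDegree ≤ m)
    (hb : b ≠ 0 → 2 + b.natDegree ≤ m) :
    curveDelta q (AdjoinRoot.of (curvePoly q) a +
      AdjoinRoot.of (curvePoly q) b * AdjoinRoot.root (curvePoly q)) ≤ m := by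
  rw [curveDelta, repA_of_add_of_mul_root, repB_of_add_of_mul_root]
  split_ifs with h
  · exact ha
  · exact max_le ha (hb h)

lemma HasSosCertificate.isSosLe {f₀ h₀ : ℝ[X]} (hf₀ : f₀.natDegree = 2) {e : ℕ}
    (h : HasSosCertificate f₀ h₀ (2 * e)) :
    IsSosLe (f₀ * h₀) (AdjoinRoot.of (curvePoly (f₀ * h₀)) (-f₀)) (2 + e) := by
  obtain ⟨s, t, ⟨r, u, rfl⟩, ⟨k, v, rfl⟩, hst, ht, hcert⟩ := h
  obtain ⟨M, hM, hu⟩ := exists_natDegree_sum_sq u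
  obtain ⟨N, hN, hv⟩ := exists_natDegree_sum_sq v
  set o := AdjoinRoot.of (curvePoly (f₀ * h₀))
  set y := AdjoinRoot.root (curvePoly (f₀ * h₀))
  refine ⟨r + k, Fin.append (fun i => o (u i * f₀) + o 0 * y) (fun i => o 0 + o (v i) * y),
    ?_, ?_⟩
  · have hy2 : y ^ 2 = -o (f₀ * h₀) := root_curvePoly_sq _
    have hf : -f₀ = (∑ i, u i ^ 2) * f₀ ^ 2 - (∑ i, v i ^ 2) * (f₀ * h₀) := by
      linear_combination f₀ * hcert
    rw [hf]
    simp only [Fin.sum_univ_add, Fin.append_left, Fin.append_right, map_zero, zero_mul,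
      zero_add, add_zero, mul_pow, hy2, map_sub, map_mul, map_sum, map_pow, ← Finset.sum_mul]
    ring
  · intro i
    refine Fin.addCases (fun i => ?_) (fun i => ?_) i
    · rw [Fin.append_left]
      refine curveDelta_of_add_of_mul_root_le ?_ (by simp)
      have := hu i
      have := natDegree_mul_le (p := u i) (q := f₀)
      omega
    · rw [Fin.append_right]
      refine curveDelta_of_add_of_mul_root_le (by simp) fun _ => ?_
      have := hv i
      omega

lemma natDegree_eq_of_mul_sub_mul_eq_one {f₀ h₀ s t : ℝ[X]} (hf₀ : f₀.natDegree = 2)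
    (hh₀ : h₀.natDegree = 2) (h : t * h₀ - s * f₀ = 1) :
    t ≠ 0 ∧ s.natDegree = t.natDegree := by
  have hf : f₀ ≠ 0 := by rintro rfl; simp at hf₀
  have hh : h₀ ≠ 0 := by rintro rfl; simp at hh₀
  have ht : t ≠ 0 := by
    rintro rfl
    have h1 : IsUnit f₀ := .of_mul_eq_one (-s) (by linear_combination h)
    rw [natDegree_eq_zero_of_isUnit h1] at hf₀
    omega
  have hs : s ≠ 0 := by
    rintro rfl
    have h1 : IsUnit h₀ := .of_mul_eq_one t (by linear_combination h)
    rw [natDegree_eq_zero_of_isUnit h1] at hh₀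
    omega
  refine ⟨ht, ?_⟩
  have h1 : (s * f₀).natDegree = (t * h₀).natDegree := by
    rcases lt_trichotomy (s * f₀).natDegree (t * h₀).natDegree with hlt | heq | hlt
    · have := natDegree_sub_eq_left_of_natDegree_lt hlt
      rw [h, natDegree_one, natDegree_mul ht hh] at this
      omega
    · exact heq
    · have := natDegree_sub_eq_right_of_natDegree_lt hlt
      rw [h, natDegree_one, natDegree_mul hs hf] at this
      omega
  rw [natDegree_mul hs hf, natDegree_mul ht hh] at h1
  omega

lemma IsSosLe.hasSosCertificate {α β : ℝ} (hαβ : α ≠ β) {f₀ h₀ : ℝ[X]}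
    (hf₀ : f₀ = (X - C α) * (X - C β)) (hh₀ : h₀.natDegree = 2) {n : ℕ}
    (h : IsSosLe (f₀ * h₀) (AdjoinRoot.of (curvePoly (f₀ * h₀)) (-f₀)) n) :
    2 ≤ n ∧ HasSosCertificate f₀ h₀ (2 * (n - 2)) := by
  obtain ⟨r, g, hg, hδ⟩ := h
  have hf₀ne : f₀ ≠ 0 := hf₀ ▸ mul_ne_zero (X_sub_C_ne_zero α) (X_sub_C_ne_zero β)
  have hf₀deg : f₀.natDegree = 2 := by
    rw [hf₀, natDegree_mul (X_sub_C_ne_zero α) (X_sub_C_ne_zero β)]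
    simp
  let a : Fin r → ℝ[X] := fun i => repA (f₀ * h₀) (g i)
  let b : Fin r → ℝ[X] := fun i => repB (f₀ * h₀) (g i)
  have hsum : -f₀ = ∑ i, a i ^ 2 - (∑ i, b i ^ 2) * (f₀ * h₀) := by
    have h1 : AdjoinRoot.of (curvePoly (f₀ * h₀)) (-f₀) =
        AdjoinRoot.of (curvePoly (f₀ * h₀)) (∑ i, a i ^ 2 - (∑ i, b i ^ 2) * (f₀ * h₀)) +
        AdjoinRoot.of (curvePoly (f₀ * h₀)) (∑ i, 2 * a i * b i) *
          AdjoinRoot.root (curvePoly (f₀ * h₀)) := by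
      rw [hg, Finset.sum_mul, ← Finset.sum_sub_distrib, map_sum, map_sum, Finset.sum_mul,
        ← Finset.sum_add_distrib]
      refine Finset.sum_congr rfl fun i _ => ?_
      have hgi : AdjoinRoot.of _ (a i) + AdjoinRoot.of _ (b i) * AdjoinRoot.root _ = g i :=
        of_repA_add_of_repB_mul_root (f₀ * h₀) (g i)
      rw [← hgi]
      simp only [map_sub, map_mul, map_pow, map_ofNat]
      have h2 := root_curvePoly_sq (f₀ * h₀)
      rw [map_mul] at h2
      linear_combination (AdjoinRoot.of (curvePoly (f₀ * h₀)) (b i)) ^ 2 * h2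
    have h2 := repA_of_add_of_mul_root (f₀ * h₀) (-f₀) 0
    rw [map_zero, zero_mul, add_zero, h1, repA_of_add_of_mul_root] at h2
    exact h2.symm
  have hroot : ∀ x : ℝ, f₀.eval x = 0 → ∀ i, X - C x ∣ a i := by
    intro x hx i
    have h1 := congrArg (eval x) hsum
    simp only [eval_neg, eval_sub, eval_mul, eval_finsetSum, eval_pow, hx] at h1
    have h2 : ∑ i, (a i).eval x ^ 2 = 0 := by linarith
    have h3 := (Finset.sum_eq_zero_iff_of_nonneg fun i _ => sq_nonneg _).mp h2 i
      (Finset.mem_univ i)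
    exact dvd_iff_isRoot.mpr (pow_eq_zero_iff two_ne_zero |>.mp h3)
  have hdvd : ∀ i, f₀ ∣ a i := fun i => hf₀ ▸
    (isCoprime_X_sub_C_of_isUnit_sub (sub_ne_zero.mpr hαβ).isUnit).mul_dvd
      (hroot α (by simp [hf₀]) i) (hroot β (by simp [hf₀]) i)
  choose u hu using hdvd
  have hcert : (∑ i, b i ^ 2) * h₀ - (∑ i, u i ^ 2) * f₀ = 1 := by
    simp_rw [hu, mul_pow] at hsum
    rw [← Finset.mul_sum] at hsum
    apply mul_left_cancel₀ hf₀ne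
    linear_combination hsum
  obtain ⟨ht, hst⟩ := natDegree_eq_of_mul_sub_mul_eq_one hf₀deg hh₀ hcert
  have hbdeg : ∀ i, b i ≠ 0 → 2 + (b i).natDegree ≤ n := by
    intro i hi
    have h1 := hδ i
    rw [curveDelta, if_neg hi] at h1
    exact (le_max_right _ _).trans h1
  refine ⟨?_, _, _, ⟨r, u, rfl⟩, ⟨r, b, rfl⟩, hst, ?_, hcert⟩
  · obtain ⟨i, -, hi⟩ := Finset.exists_ne_zero_of_sum_ne_zero ht
    have := hbdeg i (by rintro h0; simp [h0] at hi)
    omega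
  · refine natDegree_sum_le_of_forall_le _ _ fun i _ =>
      natDegree_pow_le.trans (Nat.mul_le_mul_left 2 ?_)
    by_cases hi : b i = 0
    · simp [hi]
    · have := hbdeg i hi
      omega

/-- Lemma 4.2 / `umschreib`: for `m ≥ 2`,
`θ((x−α)(β−x)) ≤ m` iff there are sums of squares `s, t ∈ ℝ[x]` with
`deg s = deg t ≤ 2(m−2)` and `t·h₀ − s·f₀ = 1`; consequently, if `d` is the smallest
degree admitting such a certificate, then `θ((x−α)(β−x)) = 2 + d/2`. -/
theorem stability_constant_via_certificates
    (q : Polynomial ℝ) (hmonic : q.Monic) (hdeg : q.natDegree = 4)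
    (hsep : Squarefree (q.map (algebraMap ℝ ℂ)))
    (hindef : ∃ x : ℝ, q.eval x < 0)
    (α β : ℝ) (hα : q.eval α = 0) (hβ : q.eval β = 0)
    (hαβ : ∀ x : ℝ, q.eval x = 0 → α ≤ x ∧ x ≤ β)
    (h₀ : Polynomial ℝ) (hh₀ : h₀.Monic) (hh₀deg : h₀.natDegree = 2)
    (hfact : q = (X - C α) * (X - C β) * h₀) :
    (∀ m : ℕ, 2 ≤ m →
      (curveTheta q (AdjoinRoot.of (curvePoly q) ((X - C α) * (C β - X))) ≤ (m : ℕ∞) ↔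
        HasSosCertificate ((X - C α) * (X - C β)) h₀ (2 * (m - 2)))) ∧
    (∀ d : ℕ, HasSosCertificate ((X - C α) * (X - C β)) h₀ d →
      (∀ d' : ℕ, d' < d → ¬ HasSosCertificate ((X - C α) * (X - C β)) h₀ d') →
      curveTheta q (AdjoinRoot.of (curvePoly q) ((X - C α) * (C β - X))) =
        ((2 + d / 2 : ℕ) : ℕ∞)) := by
  have hne : α ≠ β := by
    rintro rfl
    have hdvd : (X - C (α : ℂ)) * (X - C (α : ℂ)) ∣ q.map (algebraMap ℝ ℂ) := by
      rw [hfact]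
      exact ⟨h₀.map (algebraMap ℝ ℂ), by simp⟩
    exact not_isUnit_X_sub_C _ (hsep _ hdvd)
  subst hfact
  have hf₀deg : ((X - C α) * (X - C β)).natDegree = 2 := by
    rw [natDegree_mul (X_sub_C_ne_zero α) (X_sub_C_ne_zero β)]
    simp
  have hneg : (X - C α) * (C β - X) = -((X - C α) * (X - C β)) := by ring
  rw [hneg]
  refine ⟨fun m hm => ?_, fun d hd hmin => ?_⟩
  · rw [curveTheta_le_iff]
    refine ⟨fun h => (h.hasSosCertificate hne rfl hh₀deg).2, fun h => ?_⟩
    have := h.isSosLe hf₀deg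
    rwa [Nat.add_sub_cancel' hm] at this
  · obtain ⟨e, rfl⟩ : ∃ e, d = 2 * e := by
      obtain ⟨s, t, hs, ⟨k, v, rfl⟩, hst, ht, hcert⟩ := hd
      obtain ⟨N, hN, -⟩ := exists_natDegree_sum_sq v
      refine ⟨N, hN ▸ (ht.antisymm (not_lt.mp fun hlt => ?_)).symm⟩
      exact hmin _ hlt ⟨s, _, hs, ⟨k, v, rfl⟩, hst, le_rfl, hcert⟩
    rw [Nat.mul_div_cancel_left e two_pos]
    refine le_antisymm ((curveTheta_le_iff _ _ _).mpr (hd.isSosLe hf₀deg)) (le_sInf ?_)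
    rintro _ ⟨n, rfl, hn⟩
    obtain ⟨hn2, hc⟩ := hn.hasSosCertificate hne rfl hh₀deg
    have := not_lt.mp fun hlt => hmin _ hlt hc
    exact_mod_cast (by omega : 2 + e ≤ n)

end
end

section
/- For every (a,b) ∈ P one has N(a,b) ≥ 2, and N(a,b) = 2 if and only if a = 0. -/
open Polynomial

noncomputable section

/-- The parameter set `P`. -/
def Pset : Set (ℝ × ℝ) :=
  {p | p.1 ^ 2 - 4 * p.2 < 0 ∨ (0 < p.1 ^ 2 - 4 * p.2 ∧ |p.1| < min 2 (p.2 + 1))}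

/-- The boundary set `P'` of the closure of `P`. -/
def Pbdry : Set (ℝ × ℝ) :=
  {p | (p.1 ^ 2 = 4 * p.2 ∧ 4 ≤ p.1 ^ 2) ∨ (|p.1| = p.2 + 1 ∧ |p.1| ≤ 2)}

/-- The quartic `q_{a,b}(x) = (x² − 1)(x² + ax + b)`. -/
def qab (a b : ℝ) : Polynomial ℝ := (X ^ 2 - 1) * (X ^ 2 + C a * X + C b)

/-- The stability constant `N(a,b) = θ(1 − x²)`, computed in `ℝ[C_{a,b}]`. -/
def Nab (a b : ℝ) : ℕ∞ :=
  curveTheta (qab a b) (AdjoinRoot.of (curvePoly (qab a b)) (1 - X ^ 2))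

/-- The class of `A(x) + B(x)·y` in `ℝ[C]`. -/
def ofPair (q A B : ℝ[X]) : CurveRing q := AdjoinRoot.mk (curvePoly q) (C B * X + C A)

lemma curveRep_ofPair (q A B : ℝ[X]) : curveRep q (ofPair q A B) = C B * X + C A := by
  rw [curveRep, ofPair, AdjoinRoot.modByMonicHom_mk, modByMonic_eq_self_iff (curvePoly_monic q)]
  rw [curvePoly, degree_X_pow_add_C (by norm_num)]
  exact degree_linear_le.trans_lt (by norm_num)

@[simp]
lemma repA_ofPair (q A B : ℝ[X]) : repA q (ofPair q A B) = A := by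
  simp [repA, curveRep_ofPair]

@[simp]
lemma repB_ofPair (q A B : ℝ[X]) : repB q (ofPair q A B) = B := by
  simp [repB, curveRep_ofPair]

lemma ofPair_rep (q : ℝ[X]) (f : CurveRing q) : ofPair q (repA q f) (repB q f) = f := by
  have hdeg : (curveRep q f).degree ≤ 1 := by
    obtain ⟨p, rfl⟩ := AdjoinRoot.mk_surjective f
    rw [curveRep, AdjoinRoot.modByMonicHom_mk]
    have h := degree_modByMonic_lt p (curvePoly_monic q)
    rw [curvePoly, degree_X_pow_add_C (by norm_num)] at h
    exact Order.le_of_lt_succ h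
  rw [ofPair, repA, repB, ← eq_X_add_C_of_degree_le_one hdeg]
  exact AdjoinRoot.mk_leftInverse (curvePoly_monic q) f

lemma of_eq_ofPair (q P : ℝ[X]) : AdjoinRoot.of (curvePoly q) P = ofPair q P 0 := by
  simp [ofPair]

lemma ofPair_sq (q A B : ℝ[X]) :
    ofPair q A B ^ 2 = ofPair q (A ^ 2 - q * B ^ 2) (2 * A * B) := by
  rw [ofPair, ofPair, ← map_pow, AdjoinRoot.mk_eq_mk]
  refine ⟨C (B ^ 2), ?_⟩
  simp only [curvePoly, map_sub, map_mul, map_pow, map_ofNat]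
  ring

lemma repA_sq (q : ℝ[X]) (f : CurveRing q) :
    repA q (f ^ 2) = repA q f ^ 2 - q * repB q f ^ 2 := by
  conv_lhs => rw [← ofPair_rep q f, ofPair_sq, repA_ofPair]

lemma repA_sum (q : ℝ[X]) {ι : Type*} (s : Finset ι) (g : ι → CurveRing q) :
    repA q (∑ i ∈ s, g i) = ∑ i ∈ s, repA q (g i) := by
  simp [repA, curveRep, finsetSum_coeff]

/-- A sum of squares representation of `P ∈ ℝ[x]` on the curve gives an identity in `ℝ[x]`. -/
lemma eq_sum_sub_of_of_eq_sum_sq {q P : ℝ[X]} {r : ℕ} {g : Fin r → CurveRing q}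
    (h : AdjoinRoot.of (curvePoly q) P = ∑ i, g i ^ 2) :
    P = ∑ i, repA q (g i) ^ 2 - q * ∑ i, repB q (g i) ^ 2 := by
  have h' := congrArg (repA q) h
  rw [of_eq_ofPair, repA_ofPair, repA_sum] at h'
  simpa [repA_sq, Finset.sum_sub_distrib, Finset.mul_sum] using h'

lemma repB_eq_zero_of_curveDelta_le_one {q : ℝ[X]} {f : CurveRing q} (h : curveDelta q f ≤ 1) :
    repB q f = 0 := by
  by_contra hB
  simp only [curveDelta, if_neg hB] at h
  omega

lemma natDegree_repB_eq_zero_of_curveDelta_le_two {q : ℝ[X]} {f : CurveRing q}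
    (h : curveDelta q f ≤ 2) : (repB q f).natDegree = 0 := by
  by_cases hB : repB q f = 0
  · simp [hB]
  · simp only [curveDelta, if_neg hB] at h
    omega

lemma IsSosLe.two_le {q : ℝ[X]} {n : ℕ}
    (h : IsSosLe q (AdjoinRoot.of (curvePoly q) (1 - X ^ 2)) n) : 2 ≤ n := by
  obtain ⟨r, g, hg, hd⟩ := h
  by_contra! hn
  have hB i : repB q (g i) = 0 := repB_eq_zero_of_curveDelta_le_one ((hd i).trans (by omega))
  have h2 := congrArg (eval 2) (eq_sum_sub_of_of_eq_sum_sq hg)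
  simp only [hB, eval_sub, eval_one, eval_pow, eval_X, eval_mul, eval_finsetSum] at h2
  have : 0 ≤ ∑ i, eval 2 (repA q (g i)) ^ 2 := Finset.sum_nonneg fun i _ => sq_nonneg _
  norm_num at h2
  linarith

lemma eval_derivative_sum_sq_eq_zero {ι : Type*} {s : Finset ι} {p : ι → ℝ[X]} {u : ℝ}
    (h : eval u (∑ i ∈ s, p i ^ 2) = 0) : eval u (derivative (∑ i ∈ s, p i ^ 2)) = 0 := by
  simp only [eval_finsetSum, eval_pow] at h
  rw [Finset.sum_eq_zero_iff_of_nonneg fun i _ => sq_nonneg _] at h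
  rw [derivative_sum, eval_finsetSum]
  refine Finset.sum_eq_zero fun i hi => ?_
  simp [derivative_pow, pow_eq_zero_iff two_ne_zero |>.mp (h i hi)]

lemma eq_zero_of_isSosLe_two {a b : ℝ}
    (h : IsSosLe (qab a b) (AdjoinRoot.of (curvePoly (qab a b)) (1 - X ^ 2)) 2) : a = 0 := by
  obtain ⟨r, g, hg, hd⟩ := h
  obtain ⟨c, hc⟩ : ∃ c : ℝ, ∑ i, repB (qab a b) (g i) ^ 2 = C c := by
    choose k hk using fun i =>
      natDegree_eq_zero.mp (natDegree_repB_eq_zero_of_curveDelta_le_two (hd i))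
    exact ⟨∑ i, k i ^ 2, by simp [← hk]⟩
  have key := eq_sum_sub_of_of_eq_sum_sq hg
  rw [hc] at key
  have hS : ∑ i, repA (qab a b) (g i) ^ 2
      = (X ^ 2 - 1) * (C c * (X ^ 2 + C a * X + C b) - 1) := by
    rw [← add_eq_of_eq_sub key, qab]
    ring
  have h1 : eval 1 (derivative (∑ i, repA (qab a b) (g i) ^ 2)) = 0 :=
    eval_derivative_sum_sq_eq_zero (by simp [hS])
  have h2 : eval (-1) (derivative (∑ i, repA (qab a b) (g i) ^ 2)) = 0 :=
    eval_derivative_sum_sq_eq_zero (by simp [hS])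
  rw [hS] at h1 h2
  simp [derivative_mul] at h1 h2
  have hc0 : c ≠ 0 := by
    rintro rfl
    norm_num at h1
  have : c * a = 0 := by linarith
  exact (mul_eq_zero.mp this).resolve_left hc0

lemma curveDelta_ofPair_le (q A B : ℝ[X]) :
    curveDelta q (ofPair q A B) ≤ max A.natDegree (2 + B.natDegree) := by
  rw [curveDelta, repA_ofPair, repB_ofPair]
  split_ifs <;> simp

lemma isSosLe_two_of_neg_one_lt {b : ℝ} (hb : -1 < b) :
    IsSosLe (qab 0 b) (AdjoinRoot.of (curvePoly (qab 0 b)) (1 - X ^ 2)) 2 := by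
  obtain ⟨s, hs⟩ : ∃ s : ℝ, s ^ 2 * (1 + b) = 1 :=
    ⟨√((1 + b)⁻¹), by
      rw [Real.sq_sqrt (inv_nonneg.mpr (by linarith)), inv_mul_cancel₀ (by linarith)]⟩
  refine ⟨2, ![ofPair _ (C s * (X ^ 2 - 1)) 0, ofPair _ 0 (C s)], ?_, ?_⟩
  · have hs' : (C s : ℝ[X]) ^ 2 * (1 + C b) = 1 := by
      simpa using congrArg (C : ℝ → ℝ[X]) hs
    have hA : (1 - X ^ 2 : ℝ[X])
        = (C s * (X ^ 2 - 1)) ^ 2 + (0 ^ 2 - qab 0 b * C s ^ 2) := by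
      rw [qab, C_0]
      linear_combination (X ^ 2 - 1) * hs'
    simp only [Fin.sum_univ_two, Matrix.cons_val_zero, Matrix.cons_val_one, ofPair_sq]
    rw [of_eq_ofPair, hA]
    simp [ofPair]
  · have hdeg : (C s * (X ^ 2 - 1) : ℝ[X]).natDegree ≤ 2 := by compute_degree
    intro i
    fin_cases i
    · exact (curveDelta_ofPair_le _ _ _).trans (by simpa using hdeg)
    · exact (curveDelta_ofPair_le _ _ _).trans (by simp)

/-- from 4.4 / `N23`: for every `(a,b) ∈ P` one has `N(a,b) ≥ 2`,
with equality iff `a = 0`. -/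
theorem stability_constant_ge_two
    (a b : ℝ) (hab : (a, b) ∈ Pset) :
    (2 : ℕ∞) ≤ Nab a b ∧ (Nab a b = 2 ↔ a = 0) := by
  have hle {n : ℕ} (h : IsSosLe (qab a b) (AdjoinRoot.of (curvePoly (qab a b)) (1 - X ^ 2)) n) :
      Nab a b ≤ n := sInf_le ⟨n, rfl, h⟩
  have htwo : (2 : ℕ∞) ≤ Nab a b := by
    refine le_sInf ?_
    rintro _ ⟨n, rfl, h⟩
    exact_mod_cast h.two_le
  refine ⟨htwo, fun h => ?_, ?_⟩
  · have hne : {d : ℕ∞ | ∃ n : ℕ, d = (n : ℕ∞) ∧ IsSosLe (qab a b)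
        (AdjoinRoot.of (curvePoly (qab a b)) (1 - X ^ 2)) n}.Nonempty := by
      rw [Set.nonempty_iff_ne_empty]
      intro he
      rw [Nab, curveTheta, he, sInf_empty] at h
      exact absurd h (by decide)
    obtain ⟨n, hn, hsos⟩ := csInf_mem hne
    have hn2 : n = 2 := by
      have : (n : ℕ∞) = 2 := hn.symm.trans h
      exact_mod_cast this
    exact eq_zero_of_isSosLe_two (hn2 ▸ hsos)
  · rintro rfl
    refine le_antisymm (hle (isSosLe_two_of_neg_one_lt ?_)) htwo
    rcases hab with h | ⟨-, h⟩
    · simp only at h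
      linarith
    · simp only [abs_zero, lt_min_iff] at h
      linarith

end
end
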